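/- Let (u, ρ) be a smooth solution of the prescribed curvature flow on [0, T) for smooth positive data f (on the closed unit disc) and j (on the unit circle), with K = e^{−2u}(−Δu) in B and k = e^{−u}(∂u/∂ν₀ + 1) on ∂B, and with constants α₁, β₁, m₀, C₁, C₂ and κ < 0 as in the curvature lower bound proposition (that is: α(t) ≤ α₁ and β(t) ≤ β₁ for all t; m₀ = ½∫_B e^{2u(·,0)} dz + ∫_{∂B} e^{u(·,0)} ds₀; C₁ ≥ sup_t max{α|ρ'|ρ^{−1}‖f‖_{L∞}, α²ρ^{−1}‖f‖²_{L∞}}; C₂ ≥ sup_t max{2β|ρ'|(π−ρ)^{−1}‖j‖_{L∞}, β²(π−ρ)^{−1}‖j‖²_{L∞}}; κ < −2(sup_B|K(·,0)| + α₁‖f‖_{L∞} + β₁‖j‖_{L∞}) and κ² − C_i + 2m₀C_iκ > 0 for i = 1, 2). Then for every t < T there holds K(z, t) ≥ κ for all z ∈ B and k(z, t) ≥ κ for all z ∈ ∂B. -/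

import Mathlib

open MeasureTheory Metric Set Filter
open scoped Real Topology ENNReal

noncomputable section

/-- The closed unit disc in `ℂ ≅ ℝ²`. -/
def cdisc : Set ℂ := Metric.closedBall 0 1

/-- The open unit disc `B`. -/
def odisc : Set ℂ := Metric.ball 0 1

/-- The unit circle `∂B`. -/
def bdry : Set ℂ := Metric.sphere 0 1

/-- The boundary point with angle `θ`. -/
def bpt (θ : ℝ) : ℂ := Complex.exp ((θ : ℂ) * Complex.I)

/-- Boundary integral with respect to arclength `ds₀`. -/
def circInt (φ : ℂ → ℝ) : ℝ := ∫ θ in (0:ℝ)..(2 * Real.pi), φ (bpt θ)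

/-- Integral over the open unit disc with respect to Lebesgue measure. -/
def ballInt (φ : ℂ → ℝ) : ℝ := ∫ z in odisc, φ z

/-- Outward normal derivative `∂w/∂ν₀(z) = z·∇w(z)` for `z ∈ ∂B`. -/
def nder (w : ℂ → ℝ) (z : ℂ) : ℝ := fderivWithin ℝ w cdisc z z

/-- The Euclidean Laplacian, computed with derivatives within the closed disc. -/
def lapW (w : ℂ → ℝ) (z : ℂ) : ℝ :=
  fderivWithin ℝ (fun x => fderivWithin ℝ w cdisc x 1) cdisc z 1 +
  fderivWithin ℝ (fun x => fderivWithin ℝ w cdisc x Complex.I) cdisc z Complex.I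

/-- The coefficient `α(t) = 2ρ(t)/∫_B f e^{2u(·,t)} dz`. -/
def alphaC (f : ℂ → ℝ) (u : ℂ → ℝ → ℝ) (ρ : ℝ → ℝ) (t : ℝ) : ℝ :=
  2 * ρ t / ballInt fun z => f z * Real.exp (2 * u z t)

/-- The coefficient `β(t) = 2(π − ρ(t))/∫_{∂B} j e^{u(·,t)} ds₀`. -/
def betaC (j : ℂ → ℝ) (u : ℂ → ℝ → ℝ) (ρ : ℝ → ℝ) (t : ℝ) : ℝ :=
  2 * (Real.pi - ρ t) / circInt fun z => j z * Real.exp (u z t)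

/-- The time domain `[0, T)` (with `T ∈ (0, ∞]`). -/
def flowDom (T : ℝ≥0∞) : Set ℝ := {t : ℝ | 0 ≤ t ∧ ENNReal.ofReal t < T}

/-- `(u, ρ)` is a smooth solution of the prescribed curvature flow on `[0, T)`:
`∂u/∂t = α f + e^{−2u} Δu` in `B`, `∂u/∂t = β j − e^{−u}(∂u/∂ν₀ + 1)` on `∂B`,
and `dρ/dt = log (β²/α)`, with `u` smooth on `closure B × [0,T)` and `ρ` C¹ with
values in `(0, π)`. -/
def IsFlow (f j : ℂ → ℝ) (T : ℝ≥0∞) (u : ℂ → ℝ → ℝ) (ρ : ℝ → ℝ) : Prop :=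
  ContDiffOn ℝ (⊤ : ℕ∞) (fun p : ℂ × ℝ => u p.1 p.2) (cdisc ×ˢ flowDom T) ∧
  ContDiffOn ℝ 1 ρ (flowDom T) ∧
  (∀ t ∈ flowDom T, ρ t ∈ Set.Ioo 0 Real.pi) ∧
  (∀ t ∈ flowDom T, 0 < t → ∀ z ∈ odisc,
    deriv (u z) t = alphaC f u ρ t * f z + Real.exp (-(2 * u z t)) * lapW (fun w => u w t) z) ∧
  (∀ t ∈ flowDom T, 0 < t → ∀ z ∈ bdry,
    deriv (u z) t = betaC j u ρ t * j z - Real.exp (-(u z t)) * (nder (fun w => u w t) z + 1)) ∧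
  (∀ t ∈ flowDom T, 0 < t →
    deriv ρ t = Real.log (betaC j u ρ t ^ 2 / alphaC f u ρ t))

/-- Gauss curvature `K = e^{−2u}(−Δu)` of the evolving metric. -/
def Kcur (u : ℂ → ℝ → ℝ) (t : ℝ) (z : ℂ) : ℝ :=
  Real.exp (-(2 * u z t)) * (- lapW (fun w => u w t) z)

/-- Boundary geodesic curvature `k = e^{−u}(∂u/∂ν₀ + 1)` of the evolving metric. -/
def kcur (u : ℂ → ℝ → ℝ) (t : ℝ) (z : ℂ) : ℝ :=
  Real.exp (-(u z t)) * (nder (fun w => u w t) z + 1)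

section DirectionalDerivative

variable {E : Type*} [NormedAddCommGroup E] [NormedSpace ℝ E] {S : Set E} {g : E → ℝ}

/-- The derivative of `g` within `S` in the direction `a`. -/
def dirD (S : Set E) (a : E) (g : E → ℝ) (p : E) : ℝ := fderivWithin ℝ g S p a

lemma contDiffOn_dirD (hS : UniqueDiffOn ℝ S) (hg : ContDiffOn ℝ (⊤ : ℕ∞) g S) (a : E) :
    ContDiffOn ℝ (⊤ : ℕ∞) (dirD S a g) S :=
  (hg.fderivWithin hS (by norm_cast)).clm_apply contDiffOn_const

lemma dirD_congr {g₁ g₂ : E → ℝ} (h : EqOn g₁ g₂ S) (a : E) :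
    EqOn (dirD S a g₁) (dirD S a g₂) S := fun p hp => by
  unfold dirD
  rw [fderivWithin_congr h (h hp)]

lemma dirD_dirD_eq (hS : UniqueDiffOn ℝ S) (hg : ContDiffOn ℝ (⊤ : ℕ∞) g S) (a b : E)
    {p : E} (hp : p ∈ S) :
    dirD S a (dirD S b g) p = fderivWithin ℝ (fderivWithin ℝ g S) S p a b := by
  have hd : ContDiffOn ℝ (⊤ : ℕ∞) (fderivWithin ℝ g S) S := hg.fderivWithin hS (by norm_cast)
  have hd' : DifferentiableWithinAt ℝ (fderivWithin ℝ g S) S p :=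
    hd.differentiableOn (by simp) p hp
  change fderivWithin ℝ (fun q => fderivWithin ℝ g S q b) S p a = _
  rw [fderivWithin_clm_apply (hS p hp) hd' (differentiableWithinAt_const b)]
  simp

lemma dirD_comm (hS : UniqueDiffOn ℝ S) (hc : S ⊆ closure (interior S))
    (hg : ContDiffOn ℝ (⊤ : ℕ∞) g S) (a b : E) :
    EqOn (dirD S a (dirD S b g)) (dirD S b (dirD S a g)) S := fun p hp => by
  rw [dirD_dirD_eq hS hg a b hp, dirD_dirD_eq hS hg b a hp]
  exact (hg p hp).isSymmSndFDerivWithinAt (by simp; norm_cast)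
    hS (hc hp) hp a b

/-- The derivative within a convex set in the direction of any other point of the set
is nonpositive at a maximum. -/
lemma dirD_sub_nonpos_of_isMaxOn {S' : Set E} (hS' : Convex ℝ S') (hsub : S' ⊆ S)
    {p q : E} (hp : p ∈ S') (hq : q ∈ S') (hg : DifferentiableWithinAt ℝ g S p)
    (hmax : IsMaxOn g S' p) : dirD S (q - p) g p ≤ 0 :=
  hmax.localize.hasFDerivWithinAt_nonpos (hg.hasFDerivWithinAt.mono hsub)
    (sub_mem_posTangentConeAt_of_segment_subset (hS'.segment_subset hp hq))

lemma hasDerivAt_line (hg : DifferentiableOn ℝ g S) {p a : E} {s : ℝ}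
    (h : S ∈ 𝓝 (p + s • a)) :
    HasDerivAt (fun r : ℝ => g (p + r • a)) (dirD S a g (p + s • a)) s := by
  have h1 : HasFDerivAt g (fderivWithin ℝ g S (p + s • a)) (p + s • a) :=
    (hg _ (mem_of_mem_nhds h)).hasFDerivWithinAt.hasFDerivAt h
  have h2 : HasDerivAt (fun r : ℝ => p + r • a) a s := by
    simpa using ((hasDerivAt_id s).smul_const a).const_add p
  exact h1.comp_hasDerivAt s h2

/-- The second derivative is nonpositive at an interior maximum. -/
lemma dirD_dirD_nonpos_of_isLocalMax (hS : UniqueDiffOn ℝ S) (hg : ContDiffOn ℝ (⊤ : ℕ∞) g S)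
    {p a : E} (hp : S ∈ 𝓝 p) (hmax : ∀ᶠ r : ℝ in 𝓝 0, g (p + r • a) ≤ g p) :
    dirD S a (dirD S a g) p ≤ 0 := by
  have hcont : Continuous fun r : ℝ => p + r • a := by fun_prop
  have hev : ∀ᶠ r : ℝ in 𝓝 0, S ∈ 𝓝 (p + r • a) := by
    have : Tendsto (fun r : ℝ => p + r • a) (𝓝 0) (𝓝 p) := by
      simpa using hcont.tendsto 0
    exact this.eventually (eventually_mem_nhds_iff.2 hp)
  have h0 : S ∈ 𝓝 (p + (0 : ℝ) • a) := by simpa using hp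
  have hgd : DifferentiableOn ℝ g S := hg.differentiableOn (by simp)
  have hd : DifferentiableOn ℝ (dirD S a g) S :=
    (contDiffOn_dirD hS hg a).differentiableOn (by simp)
  have hderiv : deriv (fun r : ℝ => g (p + r • a)) =ᶠ[𝓝 0]
      fun r : ℝ => dirD S a g (p + r • a) := by
    filter_upwards [hev] with r hr using (hasDerivAt_line hgd hr).deriv
  have hdd : deriv (deriv (fun r : ℝ => g (p + r • a))) 0 = dirD S a (dirD S a g) p := by
    rw [hderiv.deriv_eq, (hasDerivAt_line hd h0).deriv]
    simp
  have hlm : IsLocalMax (fun r : ℝ => g (p + r • a)) 0 := by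
    filter_upwards [hmax] with r hr
    simpa using hr
  by_contra! hpos
  have hmin := isLocalMin_of_deriv_deriv_pos (hdd ▸ hpos) hlm.deriv_eq_zero
    (hasDerivAt_line hgd h0).continuousAt
  have hconst : (fun r : ℝ => g (p + r • a)) =ᶠ[𝓝 0] fun _ => g (p + (0 : ℝ) • a) := by
    filter_upwards [hlm, hmin] with r h1 h2 using le_antisymm h1 h2
  have : deriv (deriv (fun r : ℝ => g (p + r • a))) 0 = 0 := by
    rw [hconst.deriv.deriv_eq]
    simp
  linarith

end DirectionalDerivative

section ParametricIntegral

variable {X : Type*} [TopologicalSpace X] [MeasurableSpace X] [OpensMeasurableSpace X] {μ : Measure X}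

lemma integrableOn_of_continuousOn_subset {s K : Set X} (hs : MeasurableSet s) (hsK : s ⊆ K)
    (hK : IsCompact K) (hμ : μ s ≠ ⊤) {φ : X → ℝ} (hφ : ContinuousOn φ K) :
    IntegrableOn φ s μ := by
  obtain ⟨C, hC⟩ := hK.exists_bound_of_continuousOn hφ
  exact .of_bound hμ.lt_top (hφ.aestronglyMeasurable_of_subset_isCompact hK hs hsK) C
    ((ae_restrict_iff' hs).2 (Eventually.of_forall fun x hx => hC x (hsK hx)))

lemma continuousOn_setIntegral_param {s K : Set X} (hs : MeasurableSet s) (hsK : s ⊆ K)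
    (hK : IsCompact K) (hμ : μ s ≠ ⊤) {I : Set ℝ} (hI : IsCompact I) {G : X → ℝ → ℝ}
    (hG : ContinuousOn (fun p : X × ℝ => G p.1 p.2) (K ×ˢ I)) :
    ContinuousOn (fun t => ∫ x in s, G x t ∂μ) I := by
  obtain ⟨C, hC⟩ := (hK.prod hI).exists_bound_of_continuousOn hG
  refine continuousOn_of_dominated (bound := fun _ => C) ?_ ?_ ?_ ?_
  · intro t ht
    exact (integrableOn_of_continuousOn_subset hs hsK hK hμ
      (hG.comp (f := fun x => (x, t)) (by fun_prop) fun x hx => ⟨hx, ht⟩)).aestronglyMeasurable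
  · intro t ht
    exact (ae_restrict_iff' hs).2 (Eventually.of_forall fun x hx => hC (x, t) ⟨hsK hx, ht⟩)
  · exact integrableOn_const hμ
  · exact (ae_restrict_iff' hs).2 (Eventually.of_forall fun x hx =>
      hG.comp (f := fun t => (x, t)) (by fun_prop) fun t ht => ⟨hsK hx, ht⟩)

lemma hasDerivAt_setIntegral_param {s K : Set X} (hs : MeasurableSet s) (hsK : s ⊆ K)
    (hK : IsCompact K) (hμ : μ s ≠ ⊤) {I : Set ℝ} (hI : IsCompact I) {t₀ : ℝ}
    (ht₀ : I ∈ 𝓝 t₀) {G G' : X → ℝ → ℝ}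
    (hG : ContinuousOn (fun p : X × ℝ => G p.1 p.2) (K ×ˢ I))
    (hG' : ContinuousOn (fun p : X × ℝ => G' p.1 p.2) (K ×ˢ I))
    (hd : ∀ x ∈ K, ∀ t ∈ I, HasDerivAt (G x) (G' x t) t) :
    HasDerivAt (fun t => ∫ x in s, G x t ∂μ) (∫ x in s, G' x t₀ ∂μ) t₀ := by
  obtain ⟨C, hC⟩ := (hK.prod hI).exists_bound_of_continuousOn hG'
  have slice : ∀ {H : X → ℝ → ℝ}, ContinuousOn (fun p : X × ℝ => H p.1 p.2) (K ×ˢ I) →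
      ∀ t ∈ I, IntegrableOn (fun x => H x t) s μ := fun hH t ht =>
    integrableOn_of_continuousOn_subset hs hsK hK hμ
      (hH.comp (f := fun x => (x, t)) (by fun_prop) fun x hx => ⟨hx, ht⟩)
  refine (hasDerivAt_integral_of_dominated_loc_of_deriv_le (F := fun t x => G x t)
    (F' := fun t x => G' x t) (bound := fun _ => C) ht₀ ?_ ?_ ?_ ?_ ?_ ?_).2
  · filter_upwards [ht₀] with t ht using (slice hG t ht).aestronglyMeasurable
  · exact slice hG t₀ (mem_of_mem_nhds ht₀)
  · exact (slice hG' t₀ (mem_of_mem_nhds ht₀)).aestronglyMeasurable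
  · exact (ae_restrict_iff' hs).2 (Eventually.of_forall fun x hx t ht =>
      hC (x, t) ⟨hsK hx, ht⟩)
  · exact integrableOn_const hμ
  · exact (ae_restrict_iff' hs).2 (Eventually.of_forall fun x hx t ht => hd x (hsK hx) t ht)

end ParametricIntegral

section DivergenceTheorem

lemma convex_cdisc : Convex ℝ cdisc := convex_closedBall 0 1

lemma isCompact_cdisc : IsCompact cdisc := isCompact_closedBall 0 1

lemma interior_cdisc : interior cdisc = odisc := interior_closedBall 0 one_ne_zero

lemma odisc_subset_cdisc : odisc ⊆ cdisc := ball_subset_closedBall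

lemma bdry_subset_cdisc : bdry ⊆ cdisc := sphere_subset_closedBall

lemma cdisc_mem_nhds {z : ℂ} (hz : z ∈ odisc) : cdisc ∈ 𝓝 z :=
  mem_interior_iff_mem_nhds.1 (interior_cdisc ▸ hz)

lemma uniqueDiffOn_cdisc : UniqueDiffOn ℝ cdisc :=
  uniqueDiffOn_convex convex_cdisc ⟨0, by rw [interior_cdisc]; simp [odisc]⟩

lemma norm_bpt (θ : ℝ) : ‖bpt θ‖ = 1 := Complex.norm_exp_ofReal_mul_I θ

lemma bpt_mem_bdry (θ : ℝ) : bpt θ ∈ bdry := by simp [bdry, norm_bpt]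

lemma continuous_bpt : Continuous bpt := by unfold bpt; fun_prop

lemma hasDerivAt_bpt (θ : ℝ) : HasDerivAt bpt (bpt θ * Complex.I) θ := by
  have h : HasDerivAt (fun s : ℝ => (s : ℂ) * Complex.I) Complex.I θ := by
    simpa using (Complex.ofRealCLM.hasDerivAt (x := θ)).mul_const Complex.I
  exact h.cexp

lemma periodic_bpt : Function.Periodic bpt (2 * π) := fun θ => by
  simp [bpt, add_mul, Complex.exp_add, Complex.exp_two_pi_mul_I]

lemma smul_bpt_mem_cdisc {r : ℝ} (h0 : 0 ≤ r) (h1 : r ≤ 1) (θ : ℝ) : r • bpt θ ∈ cdisc := by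
  simpa [cdisc, norm_bpt, abs_of_nonneg h0] using h1

lemma smul_bpt_mem_odisc {r : ℝ} (h0 : 0 ≤ r) (h1 : r < 1) (θ : ℝ) : r • bpt θ ∈ odisc := by
  simpa [odisc, norm_bpt, abs_of_nonneg h0] using h1

lemma lapW_eq {w : ℂ → ℝ} (hw : ContDiffOn ℝ (⊤ : ℕ∞) w cdisc) {z : ℂ} (hz : z ∈ cdisc) :
    lapW w z = fderivWithin ℝ (fderivWithin ℝ w cdisc) cdisc z 1 1 +
      fderivWithin ℝ (fderivWithin ℝ w cdisc) cdisc z Complex.I Complex.I := by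
  rw [← dirD_dirD_eq uniqueDiffOn_cdisc hw 1 1 hz,
    ← dirD_dirD_eq uniqueDiffOn_cdisc hw Complex.I Complex.I hz]
  rfl

lemma continuousOn_lapW {w : ℂ → ℝ} (hw : ContDiffOn ℝ (⊤ : ℕ∞) w cdisc) :
    ContinuousOn (lapW w) cdisc := by
  have h : ∀ a : ℂ, ContinuousOn (dirD cdisc a (dirD cdisc a w)) cdisc := fun a =>
    (contDiffOn_dirD uniqueDiffOn_cdisc
      (contDiffOn_dirD uniqueDiffOn_cdisc hw a) a).continuousOn
  exact (h 1).add (h Complex.I)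

/-- The trace of a real bilinear form on `ℂ` in the rotated frame `(e, ie)`, `|e| = 1`. -/
lemma trace_rotated (A : ℂ →L[ℝ] ℂ →L[ℝ] ℝ) (θ : ℝ) :
    A (bpt θ) (bpt θ) + A (bpt θ * Complex.I) (bpt θ * Complex.I) =
      A 1 1 + A Complex.I Complex.I := by
  have h1 : bpt θ = Real.cos θ • (1 : ℂ) + Real.sin θ • Complex.I := by
    simp [bpt, Complex.exp_mul_I]
  have h2 : bpt θ * Complex.I = (-Real.sin θ) • (1 : ℂ) + Real.cos θ • Complex.I := by
    rw [h1]
    simp [add_mul, mul_assoc, add_comm]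
  rw [h2, h1]
  simp only [map_add, map_smul, add_apply, smul_apply,
    smul_eq_mul]
  linear_combination (A 1 1 + A Complex.I Complex.I) * Real.sin_sq_add_cos_sq θ

/-- Integration over the unit disc in polar coordinates. -/
lemma ballInt_eq_polar {φ : ℂ → ℝ} (hφ : ContinuousOn φ cdisc) :
    ballInt φ = ∫ r in (0 : ℝ)..1, ∫ θ in (-π)..π, r * φ (r • bpt θ) := by
  have hP : ∀ p : ℝ × ℝ, Complex.polarCoord.symm p = p.1 • bpt p.2 := fun p => by
    simp [bpt, Complex.exp_mul_I, mul_add]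
  have hint : IntegrableOn (fun p : ℝ × ℝ => p.1 * φ (p.1 • bpt p.2))
      (Ioo 0 1 ×ˢ Ioo (-π) π) (volume.prod volume) := by
    refine integrableOn_of_continuousOn_subset (K := Icc 0 1 ×ˢ Icc (-π) π)
      (measurableSet_Ioo.prod measurableSet_Ioo)
      (prod_mono Ioo_subset_Icc_self Ioo_subset_Icc_self) (isCompact_Icc.prod isCompact_Icc)
      ?_ ?_
    · rw [Measure.prod_prod]
      simp
    · refine continuousOn_fst.mul (hφ.comp ?_ fun p hp => smul_bpt_mem_cdisc hp.1.1 hp.1.2 _)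
      have := continuous_bpt
      fun_prop
  rw [ballInt, ← integral_indicator (by exact measurableSet_ball),
    ← Complex.integral_comp_polarCoord_symm, polarCoord_target]
  have hcongr : ∀ p ∈ Ioi (0 : ℝ) ×ˢ Ioo (-π) π,
      p.1 • odisc.indicator φ (Complex.polarCoord.symm p) =
        (Ioo 0 1 ×ˢ Ioo (-π) π).indicator (fun p : ℝ × ℝ => p.1 * φ (p.1 • bpt p.2)) p := by
    rintro p ⟨hp1, hp2⟩
    have hp1' : 0 < p.1 := hp1
    rw [hP]
    by_cases h : p.1 < 1
    · rw [indicator_of_mem (smul_bpt_mem_odisc hp1'.le h _),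
        indicator_of_mem (show p ∈ Ioo 0 1 ×ˢ Ioo (-π) π from ⟨⟨hp1, h⟩, hp2⟩), smul_eq_mul]
    · rw [indicator_of_notMem, indicator_of_notMem, smul_zero]
      · exact fun hp => h hp.1.2
      · simpa [odisc, norm_bpt, abs_of_pos hp1'] using h
  rw [setIntegral_congr_fun (measurableSet_Ioi.prod measurableSet_Ioo) hcongr,
    setIntegral_indicator (measurableSet_Ioo.prod measurableSet_Ioo),
    inter_eq_self_of_subset_right (prod_mono Ioo_subset_Ioi_self subset_rfl),
    Measure.volume_eq_prod, setIntegral_prod _ hint,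
    intervalIntegral.integral_of_le zero_le_one, integral_Ioc_eq_integral_Ioo]
  refine setIntegral_congr_fun measurableSet_Ioo fun r _ => ?_
  simp only
  rw [intervalIntegral.integral_of_le (by linarith [Real.pi_pos]), integral_Ioc_eq_integral_Ioo]

/-- The divergence theorem for a gradient field on the unit disc. -/
theorem ballInt_lapW_eq_circInt_nder {w : ℂ → ℝ} (hw : ContDiffOn ℝ (⊤ : ℕ∞) w cdisc) :
    ballInt (lapW w) = circInt (nder w) := by
  set X := fderivWithin ℝ w cdisc with hX
  set X' := fderivWithin ℝ X cdisc with hX'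
  have hXs : ContDiffOn ℝ (⊤ : ℕ∞) X cdisc := hw.fderivWithin uniqueDiffOn_cdisc (by norm_cast)
  let P : ℝ × ℝ → ℂ := fun p => p.1 • bpt p.2
  let b' : ℝ × ℝ → ℝ × ℝ →L[ℝ] ℂ := fun p =>
    (ContinuousLinearMap.toSpanSingleton ℝ (bpt p.2 * Complex.I)).comp
      (ContinuousLinearMap.snd ℝ ℝ ℝ)
  let P' : ℝ × ℝ → ℝ × ℝ →L[ℝ] ℂ := fun p =>
    p.1 • b' p + (ContinuousLinearMap.fst ℝ ℝ ℝ).smulRight (bpt p.2)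
  have hb : ∀ p : ℝ × ℝ, HasFDerivAt (fun p : ℝ × ℝ => bpt p.2) (b' p) p := fun p =>
    (hasDerivAt_bpt p.2).hasFDerivAt.comp p hasFDerivAt_snd
  have hP : ∀ p : ℝ × ℝ, HasFDerivAt P (P' p) p := fun p => hasFDerivAt_fst.smul (hb p)
  have hbI : ∀ p : ℝ × ℝ, HasFDerivAt (fun p : ℝ × ℝ => bpt p.2 * Complex.I)
      (Complex.I • b' p) p := fun p => (hb p).mul_const Complex.I
  have hPc : Continuous P := by
    have := continuous_bpt
    fun_prop
  have hXP : ContinuousOn (fun p => X (P p)) (uIcc 0 1 ×ˢ uIcc (-π) π) := by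
    refine hXs.continuousOn.comp hPc.continuousOn fun p hp => ?_
    have h1 := hp.1
    rw [uIcc_of_le zero_le_one] at h1
    exact smul_bpt_mem_cdisc h1.1 h1.2 _
  have hXPd : ∀ p ∈ Ioo (min (0 : ℝ) 1) (max 0 1) ×ˢ Ioo (min (-π) π) (max (-π) π) \ ∅,
      HasFDerivAt (fun p => X (P p)) ((X' (P p)).comp (P' p)) p := by
    rintro p ⟨⟨hp, -⟩, -⟩
    rw [min_eq_left zero_le_one, max_eq_right zero_le_one] at hp
    have hz : P p ∈ odisc := smul_bpt_mem_odisc hp.1.le hp.2 _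
    exact (((hXs.differentiableOn (by simp)) _
      (odisc_subset_cdisc hz)).hasFDerivWithinAt.hasFDerivAt (cdisc_mem_nhds hz)).comp p (hP p)
  have hdiv : ∀ p : ℝ × ℝ, p ∈ Icc (0 : ℝ) 1 ×ˢ Icc (-π) π →
      (X (P p) ∘SL P' p + ((X' (P p)).comp (P' p)).flip (P p)) (1, 0) +
        (X (P p) ∘SL (Complex.I • b' p) +
          ((X' (P p)).comp (P' p)).flip (bpt p.2 * Complex.I)) (0, 1) =
        p.1 * lapW w (p.1 • bpt p.2) := by
    intro p hp
    rw [lapW_eq hw (smul_bpt_mem_cdisc hp.1.1 hp.1.2 _), ← trace_rotated _ p.2]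
    have hII : Complex.I * (bpt p.2 * Complex.I) = -bpt p.2 := by
      linear_combination bpt p.2 * Complex.I_mul_I
    simp [P', b', P, hII, -Complex.real_smul]
    ring
  have key := integral2_divergence_prod_of_hasFDerivAt_off_countable
    (fun p => X (P p) (P p)) (fun p => X (P p) (bpt p.2 * Complex.I))
    (fun p => X (P p) ∘SL P' p + ((X' (P p)).comp (P' p)).flip (P p))
    (fun p => X (P p) ∘SL (Complex.I • b' p) +
          ((X' (P p)).comp (P' p)).flip (bpt p.2 * Complex.I))
    0 (-π) 1 π ∅ countable_empty (hXP.clm_apply hPc.continuousOn)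
    (hXP.clm_apply (by have := continuous_bpt; fun_prop))
    (fun p hp => (hXPd p hp).clm_apply (hP p)) (fun p hp => (hXPd p hp).clm_apply (hbI p)) ?_
  · have hπ : (-π) ≤ π := by linarith [Real.pi_pos]
    have hbπ : bpt π = bpt (-π) := by
      have := periodic_bpt (-π)
      rwa [show -π + 2 * π = π by ring] at this
    rw [ballInt_eq_polar (continuousOn_lapW hw)]
    have hlhs : ∫ r in (0 : ℝ)..1, ∫ θ in (-π)..π, r * lapW w (r • bpt θ) =
        ∫ r in (0 : ℝ)..1, ∫ θ in (-π)..π,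
          ((X (P (r, θ)) ∘SL P' (r, θ) + ((X' (P (r, θ))).comp (P' (r, θ))).flip (P (r, θ))) (1, 0) +
          (X (P (r, θ)) ∘SL (Complex.I • b' (r, θ)) +
          ((X' (P (r, θ))).comp (P' (r, θ))).flip (bpt θ * Complex.I)) (0, 1)) := by
      refine intervalIntegral.integral_congr fun r hr => intervalIntegral.integral_congr
        fun θ hθ => ?_
      rw [uIcc_of_le zero_le_one] at hr
      rw [uIcc_of_le hπ] at hθ
      exact (hdiv (r, θ) ⟨hr, hθ⟩).symm
    rw [hlhs]
    refine key.trans ?_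
    have hper : Function.Periodic (fun θ => nder w (bpt θ)) (2 * π) := fun θ => by
      simp only [periodic_bpt θ]
    have hcirc : circInt (nder w) = ∫ θ in (-π)..π, nder w (bpt θ) := by
      have := hper.intervalIntegral_add_eq 0 (-π)
      rw [zero_add, show -π + 2 * π = π by ring] at this
      exact this
    simp [P, hbπ, hcirc, nder, hX]
  · rw [uIcc_of_le zero_le_one, uIcc_of_le (by linarith [Real.pi_pos])]
    refine IntegrableOn.congr_fun ?_ (fun p hp => (hdiv p hp).symm)
      (measurableSet_Icc.prod measurableSet_Icc)
    refine ContinuousOn.integrableOn_compact (isCompact_Icc.prod isCompact_Icc) ?_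
    exact continuousOn_fst.mul ((continuousOn_lapW hw).comp hPc.continuousOn
      fun p hp => smul_bpt_mem_cdisc hp.1.1 hp.1.2 _)

end DivergenceTheorem

section SpaceTime

variable {T : ℝ≥0∞}

/-- The space-time domain `closure B × [0, T)`. -/
def spaceTime (T : ℝ≥0∞) : Set (ℂ × ℝ) := cdisc ×ˢ flowDom T

lemma mem_flowDom_of_le {s t : ℝ} (ht : t ∈ flowDom T) (h0 : 0 ≤ s) (h : s ≤ t) :
    s ∈ flowDom T :=
  ⟨h0, (ENNReal.ofReal_le_ofReal h).trans_lt ht.2⟩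

lemma Icc_subset_flowDom {t : ℝ} (ht : t ∈ flowDom T) : Icc 0 t ⊆ flowDom T :=
  fun _ hs => mem_flowDom_of_le ht hs.1 hs.2

lemma zero_mem_flowDom (hT : 0 < T) : (0 : ℝ) ∈ flowDom T := ⟨le_rfl, by simpa using hT⟩

lemma exists_gt_mem_flowDom {t : ℝ} (ht : t ∈ flowDom T) : ∃ s ∈ flowDom T, t < s := by
  have hopen : IsOpen {s : ℝ | ENNReal.ofReal s < T} :=
    isOpen_lt ENNReal.continuous_ofReal continuous_const
  have h1 : ∀ᶠ s in 𝓝[>] t, ENNReal.ofReal s < T :=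
    mem_nhdsWithin_of_mem_nhds (hopen.mem_nhds ht.2)
  obtain ⟨s, hs, hts⟩ := (h1.and self_mem_nhdsWithin).exists
  exact ⟨s, ⟨ht.1.trans (le_of_lt hts), hs⟩, hts⟩

lemma flowDom_mem_nhds {t : ℝ} (ht : t ∈ flowDom T) (h0 : 0 < t) : flowDom T ∈ 𝓝 t := by
  obtain ⟨s, hs, hts⟩ := exists_gt_mem_flowDom ht
  exact mem_of_superset (Icc_mem_nhds h0 hts) (Icc_subset_flowDom hs)

lemma exists_Icc_mem_nhds {t : ℝ} (ht : t ∈ flowDom T) (h0 : 0 < t) :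
    ∃ a b : ℝ, 0 < a ∧ Icc a b ∈ 𝓝 t ∧ Icc a b ⊆ flowDom T := by
  obtain ⟨s, hs, hts⟩ := exists_gt_mem_flowDom ht
  exact ⟨t / 2, s, by linarith, Icc_mem_nhds (by linarith) hts,
    (Icc_subset_Icc_left (by linarith)).trans (Icc_subset_flowDom hs)⟩

lemma convex_flowDom : Convex ℝ (flowDom T) := by
  refine OrdConnected.convex ⟨fun x hx y hy z hz => ?_⟩
  exact mem_flowDom_of_le hy (hx.1.trans hz.1) hz.2

lemma convex_spaceTime : Convex ℝ (spaceTime T) := convex_cdisc.prod convex_flowDom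

lemma spaceTime_mem_nhds {z : ℂ} {t : ℝ} (hz : z ∈ odisc) (ht : t ∈ flowDom T) (h0 : 0 < t) :
    spaceTime T ∈ 𝓝 (z, t) :=
  prod_mem_nhds (cdisc_mem_nhds hz) (flowDom_mem_nhds ht h0)

lemma nonempty_interior_spaceTime (hT : 0 < T) : (interior (spaceTime T)).Nonempty := by
  obtain ⟨s, hs, h0⟩ := exists_gt_mem_flowDom (zero_mem_flowDom hT)
  exact ⟨(0, s), mem_interior_iff_mem_nhds.2 (spaceTime_mem_nhds (by simp [odisc]) hs h0)⟩

lemma uniqueDiffOn_spaceTime (hT : 0 < T) : UniqueDiffOn ℝ (spaceTime T) :=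
  uniqueDiffOn_convex convex_spaceTime (nonempty_interior_spaceTime hT)

lemma spaceTime_subset_closure_interior (hT : 0 < T) :
    spaceTime T ⊆ closure (interior (spaceTime T)) := by
  rw [convex_spaceTime.closure_interior_eq_closure_of_nonempty_interior
    (nonempty_interior_spaceTime hT)]
  exact subset_closure

lemma contDiffOn_slice {g : ℂ × ℝ → ℝ} (hg : ContDiffOn ℝ (⊤ : ℕ∞) g (spaceTime T)) {t : ℝ}
    (ht : t ∈ flowDom T) : ContDiffOn ℝ (⊤ : ℕ∞) (fun w => g (w, t)) cdisc :=
  hg.comp (f := fun w => (w, t)) (by fun_prop) fun _ hw => ⟨hw, ht⟩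

lemma fderivWithin_slice {g : ℂ × ℝ → ℝ} (hg : ContDiffOn ℝ (⊤ : ℕ∞) g (spaceTime T)) {t : ℝ}
    (ht : t ∈ flowDom T) {z : ℂ} (hz : z ∈ cdisc) (a : ℂ) :
    fderivWithin ℝ (fun w => g (w, t)) cdisc z a = dirD (spaceTime T) (a, 0) g (z, t) := by
  have h1 : HasFDerivWithinAt g (fderivWithin ℝ g (spaceTime T) (z, t)) (spaceTime T) (z, t) :=
    (hg.differentiableOn (by simp) (z, t) ⟨hz, ht⟩).hasFDerivWithinAt
  have h2 : HasFDerivWithinAt (fun w : ℂ => (w, t)) (ContinuousLinearMap.inl ℝ ℂ ℝ) cdisc z :=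
    (hasFDerivAt_prodMk_left z t).hasFDerivWithinAt
  have h3 := h1.comp z h2 (show MapsTo _ cdisc (spaceTime T) from fun w hw => ⟨hw, ht⟩)
  have h4 := h3.fderivWithin (uniqueDiffOn_cdisc z hz)
  change fderivWithin ℝ (g ∘ fun w => (w, t)) cdisc z a = _
  rw [h4]
  simp [dirD]

lemma hasDerivAt_slice {g : ℂ × ℝ → ℝ} (hg : ContDiffOn ℝ (⊤ : ℕ∞) g (spaceTime T)) {t : ℝ}
    (ht : t ∈ flowDom T) (h0 : 0 < t) {z : ℂ} (hz : z ∈ cdisc) :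
    HasDerivAt (fun s => g (z, s)) (dirD (spaceTime T) (0, 1) g (z, t)) t := by
  have h1 : HasFDerivWithinAt g (fderivWithin ℝ g (spaceTime T) (z, t)) (spaceTime T) (z, t) :=
    (hg.differentiableOn (by simp) (z, t) ⟨hz, ht⟩).hasFDerivWithinAt
  have h2 : HasFDerivWithinAt (fun s : ℝ => (z, s)) (ContinuousLinearMap.inr ℝ ℂ ℝ)
      (flowDom T) t := (hasFDerivAt_prodMk_right z t).hasFDerivWithinAt
  have h3 := (h1.comp t h2 fun w hw => ⟨hz, hw⟩).hasFDerivAt (flowDom_mem_nhds ht h0)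
  simpa [dirD, Function.comp_def] using h3.hasDerivAt

/-- The spatial Laplacian of a function on space-time. -/
def lapST (T : ℝ≥0∞) (g : ℂ × ℝ → ℝ) (p : ℂ × ℝ) : ℝ :=
  dirD (spaceTime T) (1, 0) (dirD (spaceTime T) (1, 0) g) p +
    dirD (spaceTime T) (Complex.I, 0) (dirD (spaceTime T) (Complex.I, 0) g) p

lemma contDiffOn_lapST (hT : 0 < T) {g : ℂ × ℝ → ℝ}
    (hg : ContDiffOn ℝ (⊤ : ℕ∞) g (spaceTime T)) :
    ContDiffOn ℝ (⊤ : ℕ∞) (lapST T g) (spaceTime T) := by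
  have hu := uniqueDiffOn_spaceTime hT
  exact (contDiffOn_dirD hu (contDiffOn_dirD hu hg _) _).add
    (contDiffOn_dirD hu (contDiffOn_dirD hu hg _) _)

lemma lapW_slice (hT : 0 < T) {g : ℂ × ℝ → ℝ} (hg : ContDiffOn ℝ (⊤ : ℕ∞) g (spaceTime T))
    {t : ℝ} (ht : t ∈ flowDom T) {z : ℂ} (hz : z ∈ cdisc) :
    lapW (fun w => g (w, t)) z = lapST T g (z, t) := by
  have h : ∀ a : ℂ, fderivWithin ℝ (fun x => fderivWithin ℝ (fun w => g (w, t)) cdisc x a)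
      cdisc z a = dirD (spaceTime T) (a, 0) (dirD (spaceTime T) (a, 0) g) (z, t) := fun a => by
    rw [← fderivWithin_slice (contDiffOn_dirD (uniqueDiffOn_spaceTime hT) hg _) ht hz]
    congr 1
    exact fderivWithin_congr (fun x hx => fderivWithin_slice hg ht hx a)
      (fderivWithin_slice hg ht hz a)
  unfold lapW lapST
  rw [h, h]

/-- The time derivative commutes with the spatial Laplacian. -/
lemma dirD_time_lapST (hT : 0 < T) {g : ℂ × ℝ → ℝ}
    (hg : ContDiffOn ℝ (⊤ : ℕ∞) g (spaceTime T)) {p : ℂ × ℝ} (hp : p ∈ spaceTime T) :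
    dirD (spaceTime T) (0, 1) (lapST T g) p =
      lapST T (dirD (spaceTime T) (0, 1) g) p := by
  have hu := uniqueDiffOn_spaceTime hT
  have hc := spaceTime_subset_closure_interior hT
  have h : ∀ a : ℂ × ℝ,
      dirD (spaceTime T) (0, 1) (dirD (spaceTime T) a (dirD (spaceTime T) a g)) p =
      dirD (spaceTime T) a (dirD (spaceTime T) a (dirD (spaceTime T) (0, 1) g)) p := fun a => by
    rw [dirD_comm hu hc (contDiffOn_dirD hu hg a) (0, 1) a hp]
    exact dirD_congr (dirD_comm hu hc hg (0, 1) a) a hp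
  have hd : ∀ a : ℂ × ℝ, DifferentiableWithinAt ℝ
      (dirD (spaceTime T) a (dirD (spaceTime T) a g)) (spaceTime T) p := fun a =>
    (contDiffOn_dirD hu (contDiffOn_dirD hu hg a) a).differentiableOn (by simp) p hp
  change fderivWithin ℝ (fun q => dirD (spaceTime T) (1, 0) (dirD (spaceTime T) (1, 0) g) q +
    dirD (spaceTime T) (Complex.I, 0) (dirD (spaceTime T) (Complex.I, 0) g) q) _ _ _ = _
  rw [fderivWithin_fun_add (hu p hp) (hd _) (hd _)]
  exact congrArg₂ (· + ·) (h _) (h _)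

end SpaceTime

section FlowIntegrals

variable {T : ℝ≥0∞} {φ : ℂ → ℝ} {u : ℂ → ℝ → ℝ}

/-- The velocity `∂u/∂t` on space-time, one-sided at time `0`. -/
def velocity (T : ℝ≥0∞) (u : ℂ → ℝ → ℝ) : ℂ × ℝ → ℝ :=
  dirD (spaceTime T) (0, 1) fun p : ℂ × ℝ => u p.1 p.2

lemma contDiffOn_velocity (hT : 0 < T)
    (hu : ContDiffOn ℝ (⊤ : ℕ∞) (fun p : ℂ × ℝ => u p.1 p.2) (spaceTime T)) :
    ContDiffOn ℝ (⊤ : ℕ∞) (velocity T u) (spaceTime T) :=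
  contDiffOn_dirD (uniqueDiffOn_spaceTime hT) hu _

lemma volume_odisc_ne_top : volume odisc ≠ ⊤ := measure_ball_lt_top.ne

lemma integrableOn_odisc {ψ : ℂ → ℝ} (hψ : ContinuousOn ψ cdisc) : IntegrableOn ψ odisc :=
  integrableOn_of_continuousOn_subset measurableSet_ball odisc_subset_cdisc isCompact_cdisc
    volume_odisc_ne_top hψ

lemma continuous_comp_bpt {ψ : ℂ → ℝ} (hψ : ContinuousOn ψ bdry) :
    Continuous fun θ => ψ (bpt θ) :=
  hψ.comp_continuous continuous_bpt bpt_mem_bdry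

lemma intervalIntegrable_comp_bpt {ψ : ℂ → ℝ} (hψ : ContinuousOn ψ bdry) :
    IntervalIntegrable (fun θ => ψ (bpt θ)) volume 0 (2 * π) :=
  (continuous_comp_bpt hψ).intervalIntegrable _ _

lemma ballInt_mono {ψ₁ ψ₂ : ℂ → ℝ} (h₁ : ContinuousOn ψ₁ cdisc) (h₂ : ContinuousOn ψ₂ cdisc)
    (h : ∀ z ∈ odisc, ψ₁ z ≤ ψ₂ z) : ballInt ψ₁ ≤ ballInt ψ₂ :=
  setIntegral_mono_on (integrableOn_odisc h₁) (integrableOn_odisc h₂) measurableSet_ball h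

lemma circInt_mono {ψ₁ ψ₂ : ℂ → ℝ} (h₁ : ContinuousOn ψ₁ bdry) (h₂ : ContinuousOn ψ₂ bdry)
    (h : ∀ z ∈ bdry, ψ₁ z ≤ ψ₂ z) : circInt ψ₁ ≤ circInt ψ₂ :=
  intervalIntegral.integral_mono_on (by positivity) (intervalIntegrable_comp_bpt h₁)
    (intervalIntegrable_comp_bpt h₂) fun θ _ => h _ (bpt_mem_bdry θ)

lemma ballInt_congr {ψ₁ ψ₂ : ℂ → ℝ} (h : ∀ z ∈ odisc, ψ₁ z = ψ₂ z) :
    ballInt ψ₁ = ballInt ψ₂ :=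
  setIntegral_congr_fun measurableSet_ball h

lemma circInt_congr {ψ₁ ψ₂ : ℂ → ℝ} (h : ∀ z ∈ bdry, ψ₁ z = ψ₂ z) :
    circInt ψ₁ = circInt ψ₂ :=
  intervalIntegral.integral_congr fun θ _ => h _ (bpt_mem_bdry θ)

lemma ballInt_add {ψ₁ ψ₂ : ℂ → ℝ} (h₁ : ContinuousOn ψ₁ cdisc) (h₂ : ContinuousOn ψ₂ cdisc) :
    ballInt (fun z => ψ₁ z + ψ₂ z) = ballInt ψ₁ + ballInt ψ₂ :=
  integral_add (integrableOn_odisc h₁) (integrableOn_odisc h₂)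

lemma ballInt_sub {ψ₁ ψ₂ : ℂ → ℝ} (h₁ : ContinuousOn ψ₁ cdisc) (h₂ : ContinuousOn ψ₂ cdisc) :
    ballInt (fun z => ψ₁ z - ψ₂ z) = ballInt ψ₁ - ballInt ψ₂ :=
  integral_sub (integrableOn_odisc h₁) (integrableOn_odisc h₂)

lemma ballInt_const_mul (c : ℝ) (ψ : ℂ → ℝ) :
    ballInt (fun z => c * ψ z) = c * ballInt ψ :=
  integral_const_mul c ψ

lemma circInt_add {ψ₁ ψ₂ : ℂ → ℝ} (h₁ : ContinuousOn ψ₁ bdry) (h₂ : ContinuousOn ψ₂ bdry) :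
    circInt (fun z => ψ₁ z + ψ₂ z) = circInt ψ₁ + circInt ψ₂ :=
  intervalIntegral.integral_add (intervalIntegrable_comp_bpt h₁) (intervalIntegrable_comp_bpt h₂)

lemma circInt_sub {ψ₁ ψ₂ : ℂ → ℝ} (h₁ : ContinuousOn ψ₁ bdry) (h₂ : ContinuousOn ψ₂ bdry) :
    circInt (fun z => ψ₁ z - ψ₂ z) = circInt ψ₁ - circInt ψ₂ :=
  intervalIntegral.integral_sub (intervalIntegrable_comp_bpt h₁) (intervalIntegrable_comp_bpt h₂)

lemma circInt_const_mul (c : ℝ) (ψ : ℂ → ℝ) :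
    circInt (fun z => c * ψ z) = c * circInt ψ :=
  intervalIntegral.integral_const_mul c fun θ => ψ (bpt θ)

lemma circInt_const (c : ℝ) : circInt (fun _ => c) = 2 * π * c := by
  simp [circInt]

lemma ballInt_pos {ψ : ℂ → ℝ} (hc : ContinuousOn ψ cdisc) (h : ∀ z ∈ odisc, 0 < ψ z) :
    0 < ballInt ψ := by
  refine (setIntegral_pos_iff_support_of_nonneg_ae ?_ (integrableOn_odisc hc)).2 ?_
  · exact (ae_restrict_iff' measurableSet_ball).2 (Eventually.of_forall fun z hz => (h z hz).le)
  · rw [inter_eq_self_of_subset_right (show odisc ⊆ Function.support ψ from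
      fun z hz => (h z hz).ne')]
    exact measure_ball_pos _ _ one_pos

lemma circInt_pos {ψ : ℂ → ℝ} (hc : ContinuousOn ψ bdry) (h : ∀ z ∈ bdry, 0 < ψ z) :
    0 < circInt ψ :=
  intervalIntegral.intervalIntegral_pos_of_pos_on (intervalIntegrable_comp_bpt hc)
    (fun θ _ => h _ (bpt_mem_bdry θ)) (by positivity)

lemma continuousOn_slice {g : ℂ × ℝ → ℝ} (hg : ContinuousOn g (spaceTime T)) {t : ℝ}
    (ht : t ∈ flowDom T) : ContinuousOn (fun z => g (z, t)) cdisc :=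
  hg.comp (f := fun z => (z, t)) (by fun_prop) fun _ hz => ⟨hz, ht⟩

lemma continuousOn_time {g : ℂ × ℝ → ℝ} (hg : ContinuousOn g (spaceTime T)) {z : ℂ}
    (hz : z ∈ cdisc) : ContinuousOn (fun t => g (z, t)) (flowDom T) :=
  hg.comp (f := fun t => (z, t)) (by fun_prop) fun _ ht => ⟨hz, ht⟩

lemma continuousOn_weight {K : Set ℂ} {I : Set ℝ} (hK : K ⊆ cdisc) (hI : I ⊆ flowDom T)
    (hφ : ContinuousOn φ K)
    (hu : ContDiffOn ℝ (⊤ : ℕ∞) (fun p : ℂ × ℝ => u p.1 p.2) (spaceTime T)) (c : ℝ) :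
    ContinuousOn (fun p : ℂ × ℝ => φ p.1 * Real.exp (c * u p.1 p.2)) (K ×ˢ I) := by
  have h1 : ContinuousOn (fun p : ℂ × ℝ => u p.1 p.2) (K ×ˢ I) :=
    hu.continuousOn.mono (prod_mono hK hI)
  have h2 : ContinuousOn (fun p : ℂ × ℝ => φ p.1) (K ×ˢ I) :=
    hφ.comp continuousOn_fst fun p hp => hp.1
  exact h2.mul (Real.continuous_exp.comp_continuousOn (h1.const_mul c))

lemma continuousOn_weight_deriv (hT : 0 < T) {K : Set ℂ} {I : Set ℝ} (hK : K ⊆ cdisc)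
    (hI : I ⊆ flowDom T) (hφ : ContinuousOn φ K)
    (hu : ContDiffOn ℝ (⊤ : ℕ∞) (fun p : ℂ × ℝ => u p.1 p.2) (spaceTime T)) (c : ℝ) :
    ContinuousOn (fun p : ℂ × ℝ => φ p.1 * (Real.exp (c * u p.1 p.2) *
      (c * velocity T u p))) (K ×ˢ I) := by
  have h1 : ContinuousOn (fun p : ℂ × ℝ => u p.1 p.2) (K ×ˢ I) :=
    hu.continuousOn.mono (prod_mono hK hI)
  have h2 : ContinuousOn (fun p : ℂ × ℝ => φ p.1) (K ×ˢ I) :=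
    hφ.comp continuousOn_fst fun p hp => hp.1
  have h3 : ContinuousOn (velocity T u) (K ×ˢ I) :=
    (contDiffOn_velocity hT hu).continuousOn.mono (prod_mono hK hI)
  exact h2.mul ((Real.continuous_exp.comp_continuousOn (h1.const_mul c)).mul (h3.const_mul c))

lemma hasDerivAt_weight
    (hu : ContDiffOn ℝ (⊤ : ℕ∞) (fun p : ℂ × ℝ => u p.1 p.2) (spaceTime T)) (c a : ℝ) {z : ℂ}
    (hz : z ∈ cdisc) {t : ℝ} (ht : t ∈ flowDom T) (h0 : 0 < t) :
    HasDerivAt (fun t => a * Real.exp (c * u z t)) (a * (Real.exp (c * u z t) *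
      (c * velocity T u (z, t)))) t :=
  (((hasDerivAt_slice hu ht h0 hz).const_mul c).exp).const_mul a

lemma hasDerivAt_ballInt_weight (hT : 0 < T) (hφ : ContinuousOn φ cdisc)
    (hu : ContDiffOn ℝ (⊤ : ℕ∞) (fun p : ℂ × ℝ => u p.1 p.2) (spaceTime T)) (c : ℝ)
    {t : ℝ} (ht : t ∈ flowDom T) (h0 : 0 < t) :
    HasDerivAt (fun t => ballInt fun z => φ z * Real.exp (c * u z t))
      (ballInt fun z => φ z * (Real.exp (c * u z t) *
        (c * velocity T u (z, t)))) t := by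
  obtain ⟨a, b, ha, hab, hsub⟩ := exists_Icc_mem_nhds ht h0
  exact hasDerivAt_setIntegral_param (G := fun z t => φ z * Real.exp (c * u z t))
    (G' := fun z t => φ z * (Real.exp (c * u z t) *
        (c * velocity T u (z, t))))
    measurableSet_ball odisc_subset_cdisc isCompact_cdisc volume_odisc_ne_top isCompact_Icc hab
    (continuousOn_weight subset_rfl hsub hφ hu c)
    (continuousOn_weight_deriv hT subset_rfl hsub hφ hu c)
    fun z hz s hs => hasDerivAt_weight hu c _ hz (hsub hs) (ha.trans_le hs.1)

lemma continuousOn_ballInt_weight (hφ : ContinuousOn φ cdisc)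
    (hu : ContDiffOn ℝ (⊤ : ℕ∞) (fun p : ℂ × ℝ => u p.1 p.2) (spaceTime T)) (c : ℝ)
    {t : ℝ} (ht : t ∈ flowDom T) :
    ContinuousOn (fun t => ballInt fun z => φ z * Real.exp (c * u z t)) (Icc 0 t) :=
  continuousOn_setIntegral_param measurableSet_ball odisc_subset_cdisc isCompact_cdisc
    volume_odisc_ne_top isCompact_Icc
    (continuousOn_weight subset_rfl (Icc_subset_flowDom ht) hφ hu c)

lemma continuousOn_comp_bpt_prod {G : ℂ → ℝ → ℝ} {I : Set ℝ}
    (hG : ContinuousOn (fun p : ℂ × ℝ => G p.1 p.2) (bdry ×ˢ I)) :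
    ContinuousOn (fun p : ℝ × ℝ => G (bpt p.1) p.2) (Icc 0 (2 * π) ×ˢ I) := by
  have hb := continuous_bpt
  exact hG.comp (f := fun p : ℝ × ℝ => (bpt p.1, p.2)) (by fun_prop)
    fun p hp => ⟨bpt_mem_bdry _, hp.2⟩

lemma circInt_eq_setIntegral (ψ : ℂ → ℝ) :
    circInt ψ = ∫ θ in Ioc 0 (2 * π), ψ (bpt θ) :=
  intervalIntegral.integral_of_le (by positivity)

lemma hasDerivAt_circInt_weight (hT : 0 < T) (hφ : ContinuousOn φ bdry)
    (hu : ContDiffOn ℝ (⊤ : ℕ∞) (fun p : ℂ × ℝ => u p.1 p.2) (spaceTime T)) (c : ℝ)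
    {t : ℝ} (ht : t ∈ flowDom T) (h0 : 0 < t) :
    HasDerivAt (fun t => circInt fun z => φ z * Real.exp (c * u z t))
      (circInt fun z => φ z * (Real.exp (c * u z t) *
        (c * velocity T u (z, t)))) t := by
  obtain ⟨a, b, ha, hab, hsub⟩ := exists_Icc_mem_nhds ht h0
  simp only [circInt_eq_setIntegral]
  exact hasDerivAt_setIntegral_param (G := fun θ t => φ (bpt θ) * Real.exp (c * u (bpt θ) t))
    (G' := fun θ t => φ (bpt θ) * (Real.exp (c * u (bpt θ) t) *
        (c * velocity T u (bpt θ, t))))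
    measurableSet_Ioc Ioc_subset_Icc_self isCompact_Icc measure_Ioc_lt_top.ne isCompact_Icc hab
    (continuousOn_comp_bpt_prod (G := fun z t => φ z * Real.exp (c * u z t))
      (continuousOn_weight bdry_subset_cdisc hsub hφ hu c))
    (continuousOn_comp_bpt_prod (G := fun z t => φ z * (Real.exp (c * u z t) *
        (c * velocity T u (z, t))))
      (continuousOn_weight_deriv hT bdry_subset_cdisc hsub hφ hu c))
    fun θ _ s hs => hasDerivAt_weight hu c _ (bdry_subset_cdisc (bpt_mem_bdry θ)) (hsub hs)
      (ha.trans_le hs.1)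

lemma continuousOn_circInt_weight (hφ : ContinuousOn φ bdry)
    (hu : ContDiffOn ℝ (⊤ : ℕ∞) (fun p : ℂ × ℝ => u p.1 p.2) (spaceTime T)) (c : ℝ)
    {t : ℝ} (ht : t ∈ flowDom T) :
    ContinuousOn (fun t => circInt fun z => φ z * Real.exp (c * u z t)) (Icc 0 t) := by
  simp only [circInt_eq_setIntegral]
  exact continuousOn_setIntegral_param measurableSet_Ioc Ioc_subset_Icc_self isCompact_Icc
    measure_Ioc_lt_top.ne isCompact_Icc
    (continuousOn_comp_bpt_prod (G := fun z t => φ z * Real.exp (c * u z t))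
      (continuousOn_weight bdry_subset_cdisc (Icc_subset_flowDom ht) hφ hu c))

end FlowIntegrals

section FlowEvolution

variable {f j : ℂ → ℝ} {T : ℝ≥0∞} {u : ℂ → ℝ → ℝ} {ρ : ℝ → ℝ}

lemma IsFlow.contDiffOn (h : IsFlow f j T u ρ) :
    ContDiffOn ℝ (⊤ : ℕ∞) (fun p : ℂ × ℝ => u p.1 p.2) (spaceTime T) := h.1

lemma deriv_eq_velocity (h : IsFlow f j T u ρ) {z : ℂ} (hz : z ∈ cdisc) {t : ℝ}
    (ht : t ∈ flowDom T) (h0 : 0 < t) : deriv (u z) t = velocity T u (z, t) :=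
  (hasDerivAt_slice h.contDiffOn ht h0 hz).deriv

lemma velocity_interior (hT : 0 < T) (h : IsFlow f j T u ρ) {z : ℂ} (hz : z ∈ odisc) {t : ℝ}
    (ht : t ∈ flowDom T) (h0 : 0 < t) :
    velocity T u (z, t) = alphaC f u ρ t * f z +
      Real.exp (-(2 * u z t)) * lapST T (fun p => u p.1 p.2) (z, t) := by
  rw [← deriv_eq_velocity h (odisc_subset_cdisc hz) ht h0, h.2.2.2.1 t ht h0 z hz,
    ← lapW_slice hT h.contDiffOn ht (odisc_subset_cdisc hz)]

lemma velocity_boundary (h : IsFlow f j T u ρ) {z : ℂ} (hz : z ∈ bdry) {t : ℝ}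
    (ht : t ∈ flowDom T) (h0 : 0 < t) :
    velocity T u (z, t) = betaC j u ρ t * j z -
      Real.exp (-(u z t)) * (dirD (spaceTime T) (z, 0) (fun p => u p.1 p.2) (z, t) + 1) := by
  rw [← deriv_eq_velocity h (bdry_subset_cdisc hz) ht h0, h.2.2.2.2.1 t ht h0 z hz,
    ← fderivWithin_slice h.contDiffOn ht (bdry_subset_cdisc hz)]
  rfl

/-- Evolution equation of the velocity in the interior. -/
lemma velocity_evolution_interior (hT : 0 < T) (h : IsFlow f j T u ρ) {z : ℂ} (hz : z ∈ odisc)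
    {t : ℝ} (ht : t ∈ flowDom T) (h0 : 0 < t) {α' : ℝ} (hα : HasDerivAt (alphaC f u ρ) α' t) :
    dirD (spaceTime T) (0, 1) (velocity T u) (z, t) =
      α' * f z + 2 * velocity T u (z, t) * (alphaC f u ρ t * f z - velocity T u (z, t)) +
        Real.exp (-(2 * u z t)) * lapST T (velocity T u) (z, t) := by
  have hz' := odisc_subset_cdisc hz
  have h1 := hasDerivAt_slice (contDiffOn_velocity hT h.contDiffOn) ht h0 hz'
  have hU := hasDerivAt_slice h.contDiffOn ht h0 hz'
  have hL := hasDerivAt_slice (contDiffOn_lapST hT h.contDiffOn) ht h0 hz'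
  rw [dirD_time_lapST hT h.contDiffOn ⟨hz', ht⟩] at hL
  have h2 := (hα.mul_const (f z)).add ((hU.const_mul 2).neg.exp.mul hL)
  have heq : (fun s => velocity T u (z, s)) =ᶠ[𝓝 t] fun s => alphaC f u ρ s * f z +
      Real.exp (-(2 * u z s)) * lapST T (fun p => u p.1 p.2) (z, s) := by
    filter_upwards [flowDom_mem_nhds ht h0, lt_mem_nhds h0] with s hs hs0
    exact velocity_interior hT h hz hs hs0
  have h3 := h1.unique (h2.congr_of_eventuallyEq heq)
  rw [h3]
  change α' * f z + (Real.exp (-(2 * u z t)) * -(2 * velocity T u (z, t)) *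
    lapST T (fun p => u p.1 p.2) (z, t) +
      Real.exp (-(2 * u z t)) * lapST T (velocity T u) (z, t)) = _
  linear_combination (2 * velocity T u (z, t)) * velocity_interior hT h hz ht h0

/-- Evolution equation of the velocity on the boundary. -/
lemma velocity_evolution_boundary (hT : 0 < T) (h : IsFlow f j T u ρ) {z : ℂ} (hz : z ∈ bdry)
    {t : ℝ} (ht : t ∈ flowDom T) (h0 : 0 < t) {β' : ℝ} (hβ : HasDerivAt (betaC j u ρ) β' t) :
    dirD (spaceTime T) (0, 1) (velocity T u) (z, t) =
      β' * j z + velocity T u (z, t) * (betaC j u ρ t * j z - velocity T u (z, t)) -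
        Real.exp (-(u z t)) * dirD (spaceTime T) (z, 0) (velocity T u) (z, t) := by
  have hz' := bdry_subset_cdisc hz
  have hu := uniqueDiffOn_spaceTime hT
  have h1 := hasDerivAt_slice (contDiffOn_velocity hT h.contDiffOn) ht h0 hz'
  have hU := hasDerivAt_slice h.contDiffOn ht h0 hz'
  have hN := hasDerivAt_slice (contDiffOn_dirD hu h.contDiffOn (z, 0)) ht h0 hz'
  rw [dirD_comm hu (spaceTime_subset_closure_interior hT) h.contDiffOn (0, 1) (z, 0)
    ⟨hz', ht⟩] at hN
  have h2 := (hβ.mul_const (j z)).sub (hU.neg.exp.mul (hN.add_const 1))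
  have heq : (fun s => velocity T u (z, s)) =ᶠ[𝓝 t] fun s => betaC j u ρ s * j z -
      Real.exp (-(u z s)) * (dirD (spaceTime T) (z, 0) (fun p => u p.1 p.2) (z, s) + 1) := by
    filter_upwards [flowDom_mem_nhds ht h0, lt_mem_nhds h0] with s hs hs0
    exact velocity_boundary h hz hs hs0
  have h3 := h1.unique (h2.congr_of_eventuallyEq heq)
  rw [h3]
  change β' * j z - (Real.exp (-(u z t)) * -(velocity T u (z, t)) *
    (dirD (spaceTime T) (z, 0) (fun p => u p.1 p.2) (z, t) + 1) +
      Real.exp (-(u z t)) * dirD (spaceTime T) (z, 0) (velocity T u) (z, t)) = _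
  linear_combination velocity T u (z, t) * velocity_boundary h hz ht h0

lemma continuousOn_u (h : IsFlow f j T u ρ) {t : ℝ} (ht : t ∈ flowDom T) :
    ContinuousOn (fun z => u z t) cdisc :=
  continuousOn_slice h.contDiffOn.continuousOn ht

lemma continuousOn_velocity (hT : 0 < T) (h : IsFlow f j T u ρ) {t : ℝ} (ht : t ∈ flowDom T) :
    ContinuousOn (fun z => velocity T u (z, t)) cdisc :=
  continuousOn_slice (contDiffOn_velocity hT h.contDiffOn).continuousOn ht

lemma continuousOn_exp_u (h : IsFlow f j T u ρ) (c : ℝ) {t : ℝ} (ht : t ∈ flowDom T) :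
    ContinuousOn (fun z => Real.exp (c * u z t)) cdisc :=
  Real.continuous_exp.comp_continuousOn ((continuousOn_u h ht).const_mul c)

lemma interior_mass_pos (hf : ContinuousOn f cdisc) (hfpos : ∀ z ∈ cdisc, 0 < f z)
    (h : IsFlow f j T u ρ) {t : ℝ} (ht : t ∈ flowDom T) :
    0 < ballInt fun z => f z * Real.exp (2 * u z t) :=
  ballInt_pos (hf.mul (continuousOn_exp_u h 2 ht)) fun z hz =>
    mul_pos (hfpos z (odisc_subset_cdisc hz)) (Real.exp_pos _)

lemma boundary_mass_pos (hj : ContinuousOn j bdry) (hjpos : ∀ z ∈ bdry, 0 < j z)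
    (h : IsFlow f j T u ρ) {t : ℝ} (ht : t ∈ flowDom T) :
    0 < circInt fun z => j z * Real.exp (u z t) := by
  refine circInt_pos (hj.mul ?_) fun z hz => mul_pos (hjpos z hz) (Real.exp_pos _)
  exact Real.continuous_exp.comp_continuousOn ((continuousOn_u h ht).mono bdry_subset_cdisc)

lemma alphaC_pos (hf : ContinuousOn f cdisc) (hfpos : ∀ z ∈ cdisc, 0 < f z)
    (h : IsFlow f j T u ρ) {t : ℝ} (ht : t ∈ flowDom T) : 0 < alphaC f u ρ t :=
  div_pos (mul_pos two_pos (h.2.2.1 t ht).1) (interior_mass_pos hf hfpos h ht)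

lemma betaC_pos (hj : ContinuousOn j bdry) (hjpos : ∀ z ∈ bdry, 0 < j z)
    (h : IsFlow f j T u ρ) {t : ℝ} (ht : t ∈ flowDom T) : 0 < betaC j u ρ t :=
  div_pos (mul_pos two_pos (sub_pos.2 (h.2.2.1 t ht).2)) (boundary_mass_pos hj hjpos h ht)

lemma hasDerivAt_rho (h : IsFlow f j T u ρ) {t : ℝ} (ht : t ∈ flowDom T) (h0 : 0 < t) :
    HasDerivAt ρ (deriv ρ t) t :=
  ((h.2.1.differentiableOn (by simp) t ht).differentiableAt (flowDom_mem_nhds ht h0)).hasDerivAt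

lemma hasDerivAt_alphaC (hT : 0 < T) (hf : ContinuousOn f cdisc) (hfpos : ∀ z ∈ cdisc, 0 < f z)
    (h : IsFlow f j T u ρ) {t : ℝ} (ht : t ∈ flowDom T) (h0 : 0 < t) :
    HasDerivAt (alphaC f u ρ) (alphaC f u ρ t * deriv ρ t / ρ t -
      alphaC f u ρ t ^ 2 / ρ t *
        ballInt fun z => f z * (Real.exp (2 * u z t) * velocity T u (z, t))) t := by
  have hI := interior_mass_pos hf hfpos h ht
  have hρ := (h.2.2.1 t ht).1
  have h1 := hasDerivAt_ballInt_weight hT hf h.contDiffOn 2 ht h0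
  have h2 : (ballInt fun z => f z * (Real.exp (2 * u z t) * (2 * velocity T u (z, t)))) =
      2 * ballInt fun z => f z * (Real.exp (2 * u z t) * velocity T u (z, t)) := by
    rw [← ballInt_const_mul]
    exact ballInt_congr fun z _ => by ring
  rw [h2] at h1
  refine (((hasDerivAt_rho h ht h0).const_mul 2).div h1 hI.ne').congr_deriv ?_
  unfold alphaC
  generalize (ballInt fun z => f z * Real.exp (2 * u z t)) = I at hI ⊢
  field_simp

lemma hasDerivAt_betaC (hT : 0 < T) (hj : ContinuousOn j bdry) (hjpos : ∀ z ∈ bdry, 0 < j z)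
    (h : IsFlow f j T u ρ) {t : ℝ} (ht : t ∈ flowDom T) (h0 : 0 < t) :
    HasDerivAt (betaC j u ρ) (-(betaC j u ρ t * deriv ρ t / (π - ρ t)) -
      betaC j u ρ t ^ 2 / (π - ρ t) / 2 *
        circInt fun z => j z * (Real.exp (u z t) * velocity T u (z, t))) t := by
  have hI := boundary_mass_pos hj hjpos h ht
  have hρ := sub_pos.2 (h.2.2.1 t ht).2
  have h1 := hasDerivAt_circInt_weight hT hj h.contDiffOn 1 ht h0
  simp only [one_mul] at h1
  refine ((((hasDerivAt_rho h ht h0).const_sub π).const_mul 2).div h1 hI.ne').congr_deriv ?_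
  unfold betaC
  generalize (circInt fun z => j z * Real.exp (u z t)) = I at hI ⊢
  field_simp

/-- Gauss-Bonnet: the total velocity vanishes. -/
lemma total_velocity_eq_zero (hT : 0 < T) (hf : ContinuousOn f cdisc)
    (hfpos : ∀ z ∈ cdisc, 0 < f z) (hj : ContinuousOn j bdry) (hjpos : ∀ z ∈ bdry, 0 < j z)
    (h : IsFlow f j T u ρ) {t : ℝ} (ht : t ∈ flowDom T) (h0 : 0 < t) :
    (ballInt fun z => Real.exp (2 * u z t) * velocity T u (z, t)) +
      (circInt fun z => Real.exp (u z t) * velocity T u (z, t)) = 0 := by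
  have hI := interior_mass_pos hf hfpos h ht
  have hL := boundary_mass_pos hj hjpos h ht
  have hw := contDiffOn_slice h.contDiffOn ht
  have hub := (continuousOn_u h ht).mono bdry_subset_cdisc
  have hb : (ballInt fun z => Real.exp (2 * u z t) * velocity T u (z, t)) =
      2 * ρ t + ballInt (lapW fun w => u w t) := by
    rw [ballInt_congr (ψ₂ := fun z => alphaC f u ρ t * (f z * Real.exp (2 * u z t)) +
        lapW (fun w => u w t) z), ballInt_add _ (continuousOn_lapW hw), ballInt_const_mul, alphaC,
      div_mul_cancel₀ _ hI.ne']
    · exact (hf.mul (continuousOn_exp_u h 2 ht)).const_mul _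
    · intro z hz
      rw [velocity_interior hT h hz ht h0,
        ← lapW_slice hT h.contDiffOn ht (odisc_subset_cdisc hz), Real.exp_neg]
      have := (Real.exp_pos (2 * u z t)).ne'
      field_simp
  have hnc : ContinuousOn (fun z => nder (fun w => u w t) z) bdry :=
    ((hw.continuousOn_fderivWithin uniqueDiffOn_cdisc (by simp)).mono
      bdry_subset_cdisc).clm_apply continuousOn_id
  have hc : (circInt fun z => Real.exp (u z t) * velocity T u (z, t)) =
      2 * (π - ρ t) - (circInt (nder fun w => u w t) + 2 * π * 1) := by
    rw [circInt_congr (ψ₂ := fun z => betaC j u ρ t * (j z * Real.exp (u z t)) -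
        (nder (fun w => u w t) z + 1)), circInt_sub, circInt_add hnc continuousOn_const,
      circInt_const_mul, circInt_const, betaC, div_mul_cancel₀ _ hL.ne']
    · exact (hj.mul (Real.continuous_exp.comp_continuousOn hub)).const_mul _
    · exact hnc.add continuousOn_const
    · intro z hz
      rw [velocity_boundary h hz ht h0,
        ← fderivWithin_slice h.contDiffOn ht (bdry_subset_cdisc hz), Real.exp_neg, nder]
      have := (Real.exp_pos (u z t)).ne'
      field_simp
  rw [hb, hc, ballInt_lapW_eq_circInt_nder hw]
  ring

/-- The flow preserves half the area plus the boundary length. -/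
lemma mass_conserved (hT : 0 < T) (hf : ContinuousOn f cdisc)
    (hfpos : ∀ z ∈ cdisc, 0 < f z) (hj : ContinuousOn j bdry) (hjpos : ∀ z ∈ bdry, 0 < j z)
    (h : IsFlow f j T u ρ) {t : ℝ} (ht : t ∈ flowDom T) (h0 : 0 < t) :
    (1 / 2) * (ballInt fun z => Real.exp (2 * u z t)) + (circInt fun z => Real.exp (u z t)) =
      (1 / 2) * (ballInt fun z => Real.exp (2 * u z 0)) +
        circInt fun z => Real.exp (u z 0) := by
  have hbc := continuousOn_ballInt_weight (φ := fun _ => 1) continuousOn_const h.contDiffOn 2 ht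
  have hcc := continuousOn_circInt_weight (φ := fun _ => 1) continuousOn_const h.contDiffOn 1 ht
  simp only [one_mul] at hbc hcc
  have hder : ∀ s ∈ Ioo 0 t, HasDerivAt
      (fun s => (1 / 2) * (ballInt fun z => Real.exp (2 * u z s)) +
        circInt fun z => Real.exp (u z s)) 0 s := by
    intro s hs
    have hsD := mem_flowDom_of_le ht hs.1.le hs.2.le
    have hb := hasDerivAt_ballInt_weight (φ := fun _ => 1) hT continuousOn_const h.contDiffOn 2
      hsD hs.1
    have hc := hasDerivAt_circInt_weight (φ := fun _ => 1) hT continuousOn_const h.contDiffOn 1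
      hsD hs.1
    simp only [one_mul] at hb hc
    refine ((hb.const_mul (1 / 2)).add hc).congr_deriv ?_
    rw [← total_velocity_eq_zero hT hf hfpos hj hjpos h hsD hs.1, ← ballInt_const_mul]
    congr 1
    exact ballInt_congr fun z _ => by ring
  obtain ⟨c, hc, hslope⟩ := exists_hasDerivAt_eq_slope
    (fun s => (1 / 2) * (ballInt fun z => Real.exp (2 * u z s)) +
      circInt fun z => Real.exp (u z s)) (fun _ => 0) h0
    ((hbc.const_mul _).add hcc) hder
  rw [eq_comm, div_eq_zero_iff] at hslope
  rcases hslope with h1 | h1 <;> linarith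

end FlowEvolution

section MaximumPrinciple

variable {f j : ℂ → ℝ} {T : ℝ≥0∞} {u : ℂ → ℝ → ℝ} {ρ : ℝ → ℝ}

lemma neg_weighted_le {F M a e v : ℝ} (ha : 0 ≤ a) (haF : a ≤ F) (hM : 0 ≤ M) (he : 0 ≤ e)
    (hv : v ≤ M) : -1 * (a * (e * v)) ≤ F * (M * e - e * v) := by
  nlinarith [mul_nonneg (mul_nonneg (sub_nonneg.2 haF) (sub_nonneg.2 hv)) he,
    mul_nonneg (mul_nonneg ha hM) he]

lemma neg_ballInt_weighted_le {φ e v : ℂ → ℝ} {F M : ℝ} (hφ : ContinuousOn φ cdisc)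
    (he : ContinuousOn e cdisc) (hv : ContinuousOn v cdisc) (hφ0 : ∀ z ∈ cdisc, 0 ≤ φ z)
    (hφF : ∀ z ∈ cdisc, φ z ≤ F) (hM : 0 ≤ M) (he0 : ∀ z ∈ cdisc, 0 ≤ e z)
    (hvM : ∀ z ∈ cdisc, v z ≤ M) :
    -(ballInt fun z => φ z * (e z * v z)) ≤
      F * (M * ballInt e - ballInt fun z => e z * v z) := by
  rw [← neg_one_mul, ← ballInt_const_mul, ← ballInt_const_mul M,
    ← ballInt_sub (ψ₂ := fun z => e z * v z) (he.const_mul M) (he.mul hv), ← ballInt_const_mul]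
  refine ballInt_mono ((hφ.mul (he.mul hv)).const_mul _)
    (((he.const_mul M).sub (he.mul hv)).const_mul F) fun z hz => ?_
  have hz' := odisc_subset_cdisc hz
  exact neg_weighted_le (hφ0 z hz') (hφF z hz') hM (he0 z hz') (hvM z hz')

lemma neg_circInt_weighted_le {φ e v : ℂ → ℝ} {F M : ℝ} (hφ : ContinuousOn φ bdry)
    (he : ContinuousOn e bdry) (hv : ContinuousOn v bdry) (hφ0 : ∀ z ∈ bdry, 0 ≤ φ z)
    (hφF : ∀ z ∈ bdry, φ z ≤ F) (hM : 0 ≤ M) (he0 : ∀ z ∈ bdry, 0 ≤ e z)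
    (hvM : ∀ z ∈ bdry, v z ≤ M) :
    -(circInt fun z => φ z * (e z * v z)) ≤
      F * (M * circInt e - circInt fun z => e z * v z) := by
  rw [← neg_one_mul, ← circInt_const_mul, ← circInt_const_mul M,
    ← circInt_sub (ψ₂ := fun z => e z * v z) (he.const_mul M) (he.mul hv), ← circInt_const_mul]
  exact circInt_mono ((hφ.mul (he.mul hv)).const_mul _)
    (((he.const_mul M).sub (he.mul hv)).const_mul F) fun z hz =>
      neg_weighted_le (hφ0 z hz) (hφF z hz) hM (he0 z hz) (hvM z hz)

/-- If the velocity is at most `M`, then the weighted total velocities are bounded below in terms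
of the conserved mass. -/
lemma weighted_velocity_bounds (hT : 0 < T) (hf : ContinuousOn f cdisc)
    (hfpos : ∀ z ∈ cdisc, 0 < f z) (hj : ContinuousOn j bdry) (hjpos : ∀ z ∈ bdry, 0 < j z)
    (h : IsFlow f j T u ρ) {t : ℝ} (ht : t ∈ flowDom T) (h0 : 0 < t) {M F J m₀ : ℝ}
    (hM : 0 ≤ M) (hF : ∀ z ∈ cdisc, f z ≤ F) (hJ : ∀ z ∈ bdry, j z ≤ J)
    (hm₀ : m₀ = (1 / 2) * ballInt (fun z => Real.exp (2 * u z 0)) +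
      circInt (fun z => Real.exp (u z 0)))
    (hV : ∀ z ∈ cdisc, velocity T u (z, t) ≤ M) :
    -(ballInt fun z => f z * (Real.exp (2 * u z t) * velocity T u (z, t))) ≤
        F * (2 * m₀ * M) ∧
      -(circInt fun z => j z * (Real.exp (u z t) * velocity T u (z, t))) ≤
        J * (2 * m₀ * M) := by
  have hE := continuousOn_exp_u h 2 ht
  have hE1 : ContinuousOn (fun z => Real.exp (u z t)) bdry :=
    Real.continuous_exp.comp_continuousOn ((continuousOn_u h ht).mono bdry_subset_cdisc)
  have hVc := continuousOn_velocity hT h ht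
  have hVb := hVc.mono bdry_subset_cdisc
  have hVM : ∀ z ∈ bdry, velocity T u (z, t) ≤ M := fun z hz => hV z (bdry_subset_cdisc hz)
  have hmass := mass_conserved hT hf hfpos hj hjpos h ht h0
  rw [← hm₀] at hmass
  have hA : 0 < ballInt fun z => Real.exp (2 * u z t) := ballInt_pos hE fun _ _ => Real.exp_pos _
  have hL : 0 < circInt fun z => Real.exp (u z t) := circInt_pos hE1 fun _ _ => Real.exp_pos _
  have hzero := total_velocity_eq_zero hT hf hfpos hj hjpos h ht h0
  have h1 := neg_ballInt_weighted_le hf hE hVc (fun z hz => (hfpos z hz).le) hF hM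
    (fun z _ => (Real.exp_pos _).le) hV
  have h2 := neg_circInt_weighted_le hj hE1 hVb (fun z hz => (hjpos z hz).le) hJ hM
    (fun z _ => (Real.exp_pos _).le) hVM
  have h3 : (ballInt fun z => Real.exp (2 * u z t) * velocity T u (z, t)) ≤
      M * ballInt fun z => Real.exp (2 * u z t) := by
    rw [← ballInt_const_mul]
    refine ballInt_mono (hE.mul hVc) (hE.const_mul M) fun z hz => ?_
    rw [mul_comm M]
    exact mul_le_mul_of_nonneg_left (hV z (odisc_subset_cdisc hz)) (Real.exp_pos _).le
  have h4 : (circInt fun z => Real.exp (u z t) * velocity T u (z, t)) ≤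
      M * circInt fun z => Real.exp (u z t) := by
    rw [← circInt_const_mul]
    refine circInt_mono (hE1.mul hVb) (hE1.const_mul M) fun z hz => ?_
    rw [mul_comm M]
    exact mul_le_mul_of_nonneg_left (hVM z hz) (Real.exp_pos _).le
  have hF0 : 0 ≤ F := (hfpos 0 (by simp [cdisc])).le.trans (hF 0 (by simp [cdisc]))
  have hJ0 : 0 ≤ J := (hjpos 1 (by simp [bdry])).le.trans (hJ 1 (by simp [bdry]))
  refine ⟨h1.trans (mul_le_mul_of_nonneg_left ?_ hF0), h2.trans (mul_le_mul_of_nonneg_left ?_ hJ0)⟩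
  · nlinarith
  · nlinarith

/-- The velocity cannot reach the level `M` for the first time at a positive time. -/
lemma velocity_not_touching (hT : 0 < T) (hf : ContinuousOn f cdisc)
    (hfpos : ∀ z ∈ cdisc, 0 < f z) (hj : ContinuousOn j bdry) (hjpos : ∀ z ∈ bdry, 0 < j z)
    (h : IsFlow f j T u ρ) {t : ℝ} (ht : t ∈ flowDom T) (h0 : 0 < t) {M F J m₀ C₁ C₂ : ℝ}
    (hM : 0 < M) (hF : ∀ z ∈ cdisc, f z ≤ F) (hJ : ∀ z ∈ bdry, j z ≤ J)
    (hm₀ : m₀ = (1 / 2) * ballInt (fun z => Real.exp (2 * u z 0)) +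
      circInt (fun z => Real.exp (u z 0)))
    (hC₁ : alphaC f u ρ t * |deriv ρ t| / ρ t * F ≤ C₁)
    (hC₁' : alphaC f u ρ t ^ 2 / ρ t * F ^ 2 ≤ C₁)
    (hC₂ : 2 * betaC j u ρ t * |deriv ρ t| / (π - ρ t) * J ≤ C₂)
    (hC₂' : betaC j u ρ t ^ 2 / (π - ρ t) * J ^ 2 ≤ C₂)
    (hαF : alphaC f u ρ t * F < M / 2) (hβJ : betaC j u ρ t * J < M / 2)
    (hM₁ : 0 < M ^ 2 - C₁ - 2 * m₀ * C₁ * M) (hM₂ : 0 < M ^ 2 - C₂ - 2 * m₀ * C₂ * M)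
    (hV : ∀ z ∈ cdisc, ∀ s ∈ Icc 0 t, velocity T u (z, s) ≤ M)
    {z : ℂ} (hz : z ∈ cdisc) : velocity T u (z, t) ≠ M := by
  intro hzM
  have hVs := contDiffOn_velocity hT h.contDiffOn
  have htt : t ∈ Icc 0 t := ⟨h0.le, le_rfl⟩
  obtain ⟨hρ0, hρπ⟩ := h.2.2.1 t ht
  have hρπ' : 0 < π - ρ t := sub_pos.2 hρπ
  have hF0 : 0 ≤ F := (hfpos 0 (by simp [cdisc])).le.trans (hF 0 (by simp [cdisc]))
  have hJ0 : 0 ≤ J := (hjpos 1 (by simp [bdry])).le.trans (hJ 1 (by simp [bdry]))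
  obtain ⟨hwf, hwj⟩ := weighted_velocity_bounds hT hf hfpos hj hjpos h ht h0 hM.le hF hJ hm₀
    fun w hw => hV w hw t htt
  have hα0 := alphaC_pos hf hfpos h ht
  have hβ0 := betaC_pos hj hjpos h ht
  have hm₀pos : 0 ≤ m₀ := by
    rw [← mass_conserved hT hf hfpos hj hjpos h ht h0] at hm₀
    rw [hm₀]
    have h1 : 0 < ballInt fun z => Real.exp (2 * u z t) :=
      ballInt_pos (continuousOn_exp_u h 2 ht) fun _ _ => Real.exp_pos _
    have h2 : 0 < circInt fun z => Real.exp (u z t) := circInt_pos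
      (Real.continuous_exp.comp_continuousOn ((continuousOn_u h ht).mono bdry_subset_cdisc))
      fun _ _ => Real.exp_pos _
    positivity
  have hsub : cdisc ×ˢ Icc 0 t ⊆ spaceTime T := prod_mono subset_rfl (Icc_subset_flowDom ht)
  have hp : (z, t) ∈ cdisc ×ˢ Icc 0 t := ⟨hz, htt⟩
  have hd := hVs.differentiableOn (by simp) (z, t) (hsub hp)
  have hmax : IsMaxOn (velocity T u) (cdisc ×ˢ Icc 0 t) (z, t) := fun q hq => by
    rw [mem_ofPred_eq, hzM]
    exact hV q.1 hq.1 q.2 hq.2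
  have hconv : Convex ℝ (cdisc ×ˢ Icc (0 : ℝ) t) := convex_cdisc.prod (convex_Icc _ _)
  have htime : 0 ≤ dirD (spaceTime T) (0, 1) (velocity T u) (z, t) := by
    have h1 := dirD_sub_nonpos_of_isMaxOn hconv hsub hp
      (show (z, (0 : ℝ)) ∈ _ from ⟨hz, le_rfl, h0.le⟩) hd hmax
    have h2 : ((z, 0) - (z, t) : ℂ × ℝ) = (-t) • ((0 : ℂ), (1 : ℝ)) := by ext <;> simp
    rw [h2, dirD, map_smul, smul_eq_mul] at h1
    exact nonneg_of_mul_nonneg_right (by simpa [dirD] using h1) h0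
  by_cases hzo : z ∈ odisc
  · have hev := velocity_evolution_interior hT h hzo ht h0
      (hasDerivAt_alphaC hT hf hfpos h ht h0)
    have hlap : lapST T (velocity T u) (z, t) ≤ 0 := by
      have hdir : ∀ a : ℂ, dirD (spaceTime T) (a, 0)
          (dirD (spaceTime T) (a, 0) (velocity T u)) (z, t) ≤ 0 := fun a => by
        refine dirD_dirD_nonpos_of_isLocalMax (uniqueDiffOn_spaceTime hT) hVs
          (spaceTime_mem_nhds hzo ht h0) ?_
        have htend : Tendsto (fun r : ℝ => z + r • a) (𝓝 0) (𝓝 z) := by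
          have : Continuous fun r : ℝ => z + r • a := by fun_prop
          simpa using this.tendsto 0
        filter_upwards [htend.eventually (cdisc_mem_nhds hzo)] with r hr
        rw [hzM]
        simpa using hV _ hr t htt
      exact add_nonpos (hdir 1) (hdir Complex.I)
    rw [hzM] at hev
    have h1 : Real.exp (-(2 * u z t)) * lapST T (velocity T u) (z, t) ≤ 0 :=
      mul_nonpos_of_nonneg_of_nonpos (Real.exp_pos _).le hlap
    have hfz := hF z hz
    have hfz0 := hfpos z hz
    have h2 : alphaC f u ρ t * deriv ρ t / ρ t * f z ≤ C₁ := by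
      refine le_trans ?_ hC₁
      gcongr
      exact le_abs_self _
    have h3 : -(alphaC f u ρ t ^ 2 / ρ t *
        ballInt fun z => f z * (Real.exp (2 * u z t) * velocity T u (z, t))) * f z ≤
        C₁ * (2 * m₀ * M) := by
      calc _ = alphaC f u ρ t ^ 2 / ρ t * f z *
            -(ballInt fun z => f z * (Real.exp (2 * u z t) * velocity T u (z, t))) := by ring
        _ ≤ alphaC f u ρ t ^ 2 / ρ t * f z * (F * (2 * m₀ * M)) := by gcongr
        _ ≤ alphaC f u ρ t ^ 2 / ρ t * F * (F * (2 * m₀ * M)) := by gcongr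
        _ = alphaC f u ρ t ^ 2 / ρ t * F ^ 2 * (2 * m₀ * M) := by ring
        _ ≤ _ := by gcongr
    have h4 : alphaC f u ρ t * f z < M / 2 :=
      (mul_le_mul_of_nonneg_left hfz hα0.le).trans_lt hαF
    nlinarith
  · have hzb : z ∈ bdry := by
      have h1 : ‖z‖ ≤ 1 := by simpa [cdisc] using hz
      have h2 : 1 ≤ ‖z‖ := by simpa [odisc] using hzo
      simpa [bdry] using le_antisymm h1 h2
    have hev := velocity_evolution_boundary hT h hzb ht h0
      (hasDerivAt_betaC hT hj hjpos h ht h0)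
    have hnor : 0 ≤ dirD (spaceTime T) (z, 0) (velocity T u) (z, t) := by
      have h1 := dirD_sub_nonpos_of_isMaxOn hconv hsub hp
        (show ((0 : ℂ), t) ∈ _ from ⟨by simp [cdisc], htt⟩) hd hmax
      have h2 : ((0, t) - (z, t) : ℂ × ℝ) = -(z, (0 : ℝ)) := by ext <;> simp
      rw [h2, dirD, map_neg] at h1
      exact neg_nonpos.1 h1
    rw [hzM] at hev
    have h1 : 0 ≤ Real.exp (-(u z t)) * dirD (spaceTime T) (z, 0) (velocity T u) (z, t) :=
      mul_nonneg (Real.exp_pos _).le hnor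
    have hjz := hJ z hzb
    have hjz0 := hjpos z hzb
    have h2 : -(betaC j u ρ t * deriv ρ t / (π - ρ t)) * j z ≤ C₂ / 2 := by
      have h5 : betaC j u ρ t * |deriv ρ t| / (π - ρ t) * J ≤ C₂ / 2 := by
        rw [le_div_iff₀ two_pos]
        refine le_trans (le_of_eq ?_) hC₂
        ring
      refine le_trans ?_ h5
      rw [← neg_div, ← mul_neg]
      gcongr
      exact neg_le_abs _
    have h3 : -(betaC j u ρ t ^ 2 / (π - ρ t) / 2 *
        circInt fun z => j z * (Real.exp (u z t) * velocity T u (z, t))) * j z ≤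
        C₂ / 2 * (2 * m₀ * M) := by
      calc _ = betaC j u ρ t ^ 2 / (π - ρ t) / 2 * j z *
            -(circInt fun z => j z * (Real.exp (u z t) * velocity T u (z, t))) := by ring
        _ ≤ betaC j u ρ t ^ 2 / (π - ρ t) / 2 * j z * (J * (2 * m₀ * M)) := by gcongr
        _ ≤ betaC j u ρ t ^ 2 / (π - ρ t) / 2 * J * (J * (2 * m₀ * M)) := by gcongr
        _ = betaC j u ρ t ^ 2 / (π - ρ t) * J ^ 2 / 2 * (2 * m₀ * M) := by ring
        _ ≤ _ := by gcongr
    have h4 : betaC j u ρ t * j z < M / 2 :=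
      (mul_le_mul_of_nonneg_left hjz hβ0.le).trans_lt hβJ
    nlinarith

/-- First-time argument: a continuous function on a compact space times `[0, t]` which starts
below `M` and does not touch `M` from below stays at most `M`. -/
lemma le_of_not_touching {X : Type*} [TopologicalSpace X] [T2Space X] {K : Set X} (hK : IsCompact K)
    {t M : ℝ} {g : X × ℝ → ℝ} (hg : ContinuousOn g (K ×ˢ Icc 0 t)) (hinit : ∀ x ∈ K, g (x, 0) < M)
    (htouch : ∀ s ∈ Ioc 0 t, (∀ x ∈ K, ∀ r ∈ Icc 0 s, g (x, r) ≤ M) → ∀ x ∈ K, g (x, s) ≠ M)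
    {x : X} (hx : x ∈ K) (ht : 0 ≤ t) : g (x, t) ≤ M := by
  by_contra! hbad
  have hcomp : IsCompact ((K ×ˢ Icc 0 t) ∩ g ⁻¹' Ici M) :=
    (hK.prod isCompact_Icc).of_isClosed_subset
      (hg.preimage_isClosed_of_isClosed (hK.prod isCompact_Icc).isClosed isClosed_Ici)
      inter_subset_left
  obtain ⟨⟨y, s⟩, ⟨⟨hy, hs⟩, hM⟩, hmin⟩ := hcomp.exists_isMinOn
    ⟨(x, t), ⟨hx, ht, le_rfl⟩, hbad.le⟩ continuousOn_snd
  have hM' : M ≤ g (y, s) := hM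
  have hbelow : ∀ x' ∈ K, ∀ r ∈ Ico 0 s, g (x', r) < M := by
    intro x' hx' r hr
    by_contra! hge
    exact absurd (hmin (show (x', r) ∈ _ from ⟨⟨hx', hr.1, hr.2.le.trans hs.2⟩, hge⟩))
      (not_le.2 hr.2)
  have hs0 : 0 < s := hs.1.lt_of_ne fun h => by
    subst h
    exact absurd (hinit y hy) (not_lt.2 hM')
  have hle : ∀ x' ∈ K, ∀ r ∈ Icc 0 s, g (x', r) ≤ M := by
    intro x' hx' r hr
    have hc : ContinuousOn (fun r => g (x', r)) (Icc 0 s) :=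
      hg.comp (f := fun r => (x', r)) (by fun_prop) fun r hr => ⟨hx', hr.1, hr.2.trans hs.2⟩
    rw [← closure_Ico hs0.ne] at hc hr
    exact le_on_closure (fun r hr => (hbelow x' hx' r hr).le) hc continuousOn_const hr
  exact htouch s ⟨hs0, hs.2⟩ hle y hy (le_antisymm (hle y hy s ⟨hs.1, le_rfl⟩) hM')

end MaximumPrinciple

section InitialTime

variable {f j : ℂ → ℝ} {T : ℝ≥0∞} {u : ℂ → ℝ → ℝ} {ρ : ℝ → ℝ}

lemma le_zero_time_of_le_pos_time (hT : 0 < T) {g₁ g₂ : ℝ → ℝ}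
    (h₁ : ContinuousOn g₁ (flowDom T)) (h₂ : ContinuousOn g₂ (flowDom T))
    (hle : ∀ t ∈ flowDom T, 0 < t → g₁ t ≤ g₂ t) : g₁ 0 ≤ g₂ 0 := by
  obtain ⟨s, hs, h0⟩ := exists_gt_mem_flowDom (zero_mem_flowDom hT)
  have hsub := Icc_subset_flowDom hs
  refine le_on_closure (s := Ioc 0 s) (fun t ht => hle t (hsub (Ioc_subset_Icc_self ht)) ht.1)
    ?_ ?_ ?_ <;> rw [closure_Ioc h0.ne]
  exacts [h₁.mono hsub, h₂.mono hsub, ⟨le_rfl, h0.le⟩]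

lemma Kcur_eq_lapST (hT : 0 < T) (h : IsFlow f j T u ρ) {t : ℝ} (ht : t ∈ flowDom T) {z : ℂ}
    (hz : z ∈ cdisc) :
    Kcur u t z = Real.exp (-(2 * u z t)) * -lapST T (fun p => u p.1 p.2) (z, t) := by
  rw [Kcur, ← lapW_slice hT h.contDiffOn ht hz]

lemma kcur_eq_dirD (h : IsFlow f j T u ρ) {t : ℝ} (ht : t ∈ flowDom T) {z : ℂ}
    (hz : z ∈ cdisc) :
    kcur u t z =
      Real.exp (-(u z t)) * (dirD (spaceTime T) (z, 0) (fun p => u p.1 p.2) (z, t) + 1) := by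
  rw [kcur, nder, ← fderivWithin_slice h.contDiffOn ht hz]

lemma Kcur_eq_sub_velocity (hT : 0 < T) (h : IsFlow f j T u ρ) {t : ℝ} (ht : t ∈ flowDom T)
    (h0 : 0 < t) {z : ℂ} (hz : z ∈ odisc) :
    Kcur u t z = alphaC f u ρ t * f z - velocity T u (z, t) := by
  rw [Kcur_eq_lapST hT h ht (odisc_subset_cdisc hz), velocity_interior hT h hz ht h0]
  ring

lemma kcur_eq_sub_velocity (h : IsFlow f j T u ρ) {t : ℝ} (ht : t ∈ flowDom T)
    (h0 : 0 < t) {z : ℂ} (hz : z ∈ bdry) :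
    kcur u t z = betaC j u ρ t * j z - velocity T u (z, t) := by
  rw [kcur_eq_dirD h ht (bdry_subset_cdisc hz), velocity_boundary h hz ht h0]
  ring

lemma continuousOn_Kcur_time (hT : 0 < T) (h : IsFlow f j T u ρ) {z : ℂ} (hz : z ∈ cdisc) :
    ContinuousOn (fun t => Kcur u t z) (flowDom T) := by
  have hu := continuousOn_time h.contDiffOn.continuousOn hz
  have hl := continuousOn_time (contDiffOn_lapST hT h.contDiffOn).continuousOn hz
  exact ((Real.continuous_exp.comp_continuousOn (hu.const_mul 2).neg).mul hl.neg).congr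
    fun t ht => Kcur_eq_lapST hT h ht hz

lemma continuousOn_kcur_time (hT : 0 < T) (h : IsFlow f j T u ρ) {z : ℂ} (hz : z ∈ cdisc) :
    ContinuousOn (fun t => kcur u t z) (flowDom T) := by
  have hu := continuousOn_time h.contDiffOn.continuousOn hz
  have hd := continuousOn_time
    (contDiffOn_dirD (uniqueDiffOn_spaceTime hT) h.contDiffOn (z, 0)).continuousOn hz
  exact ((Real.continuous_exp.comp_continuousOn hu.neg).mul (hd.add continuousOn_const)).congr
    fun t ht => kcur_eq_dirD h ht hz

lemma continuousOn_Kcur (h : IsFlow f j T u ρ) {t : ℝ} (ht : t ∈ flowDom T) :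
    ContinuousOn (Kcur u t) cdisc :=
  (Real.continuous_exp.comp_continuousOn ((continuousOn_u h ht).const_mul 2).neg).mul
    (continuousOn_lapW (contDiffOn_slice h.contDiffOn ht)).neg

/-- The initial velocity is controlled by the initial Gauss curvature. -/
lemma velocity_zero_le (hT : 0 < T) (hfpos : ∀ z ∈ cdisc, 0 < f z) (h : IsFlow f j T u ρ)
    {α₁ F K₀ : ℝ} (hα : ∀ t ∈ flowDom T, alphaC f u ρ t ≤ α₁) (hα₁ : 0 ≤ α₁)
    (hF : ∀ z ∈ cdisc, f z ≤ F) (hK₀ : ∀ z ∈ odisc, |Kcur u 0 z| ≤ K₀) {z : ℂ}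
    (hz : z ∈ cdisc) : velocity T u (z, 0) ≤ α₁ * F + K₀ := by
  have hV := contDiffOn_velocity hT h.contDiffOn
  have hopen : ∀ w ∈ odisc, velocity T u (w, 0) ≤ α₁ * F + K₀ := by
    intro w hw
    have hw' := odisc_subset_cdisc hw
    have h1 := le_zero_time_of_le_pos_time hT (continuousOn_time hV.continuousOn hw')
      (continuousOn_const.sub (continuousOn_Kcur_time hT h hw')) (g₂ := fun t => α₁ * F - Kcur u t w)
      fun t ht h0 => by
        have h2 := mul_le_mul (hα t ht) (hF w hw') (hfpos w hw').le hα₁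
        have h3 := Kcur_eq_sub_velocity hT h ht h0 hw
        linarith
    have h2 := neg_le_of_abs_le (hK₀ w hw)
    linarith
  have hcl : closure odisc = cdisc := closure_ball 0 one_ne_zero
  rw [← hcl] at hz
  refine le_on_closure hopen ?_ continuousOn_const hz
  rw [hcl]
  exact continuousOn_velocity hT h (zero_mem_flowDom hT)

lemma abs_le_iSup_of_continuousOn {X : Type*} [TopologicalSpace X] {g : X → ℝ} {s K : Set X}
    (hK : IsCompact K) (hs : s ⊆ K) (hg : ContinuousOn g K) {x : X} (hx : x ∈ s) :
    |g x| ≤ ⨆ w : s, |g w| := by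
  refine le_ciSup (f := fun w : s => |g w|) ?_ ⟨x, hx⟩
  refine (hK.bddAbove_image hg.abs).mono ?_
  rintro _ ⟨w, rfl⟩
  exact ⟨w, hs w.2, rfl⟩

end InitialTime

/-- Pointwise lower bound `K ≥ κ` in `B` and `k ≥ κ` on `∂B` along the flow. -/
theorem flow_curvature_pointwise_lower_bound (f j : ℂ → ℝ)
    (hf : ContDiffOn ℝ (⊤ : ℕ∞) f cdisc) (hfpos : ∀ z ∈ cdisc, 0 < f z)
    (hj : ContDiffOn ℝ (⊤ : ℕ∞) j bdry) (hjpos : ∀ z ∈ bdry, 0 < j z)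
    (T : ℝ≥0∞) (hT : 0 < T) (u : ℂ → ℝ → ℝ) (ρ : ℝ → ℝ)
    (hflow : IsFlow f j T u ρ)
    (α₁ β₁ : ℝ)
    (hα : ∀ t ∈ flowDom T, alphaC f u ρ t ≤ α₁)
    (hβ : ∀ t ∈ flowDom T, betaC j u ρ t ≤ β₁)
    (m₀ : ℝ)
    (hm₀ : m₀ = (1 / 2) * ballInt (fun z => Real.exp (2 * u z 0)) +
      circInt (fun z => Real.exp (u z 0)))
    (C₁ C₂ : ℝ) (hC₁pos : 0 < C₁) (hC₂pos : 0 < C₂)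
    (hC₁ : ∀ t ∈ flowDom T, 0 < t →
      alphaC f u ρ t * |deriv ρ t| / ρ t * (⨆ w : cdisc, |f ↑w|) ≤ C₁ ∧
      alphaC f u ρ t ^ 2 / ρ t * (⨆ w : cdisc, |f ↑w|) ^ 2 ≤ C₁)
    (hC₂ : ∀ t ∈ flowDom T, 0 < t →
      2 * betaC j u ρ t * |deriv ρ t| / (Real.pi - ρ t) * (⨆ w : bdry, |j ↑w|) ≤ C₂ ∧
      betaC j u ρ t ^ 2 / (Real.pi - ρ t) * (⨆ w : bdry, |j ↑w|) ^ 2 ≤ C₂)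
    (κ : ℝ) (hκneg : κ < 0)
    (hκ : κ < -2 * ((⨆ w : odisc, |Kcur u 0 ↑w|) +
      α₁ * (⨆ w : cdisc, |f ↑w|) + β₁ * (⨆ w : bdry, |j ↑w|)))
    (hκ₁ : 0 < κ ^ 2 - C₁ + 2 * m₀ * C₁ * κ)
    (hκ₂ : 0 < κ ^ 2 - C₂ + 2 * m₀ * C₂ * κ) :
    ∀ t ∈ flowDom T,
      (∀ z ∈ odisc, κ ≤ Kcur u t z) ∧ (∀ z ∈ bdry, κ ≤ kcur u t z) := by
  have hfc := hf.continuousOn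
  have hjc := hj.continuousOn
  have h0T := zero_mem_flowDom hT
  set F := ⨆ w : cdisc, |f ↑w|
  set J := ⨆ w : bdry, |j ↑w|
  set K₀ := ⨆ w : odisc, |Kcur u 0 ↑w|
  have hF : ∀ z ∈ cdisc, f z ≤ F := fun z hz =>
    (le_abs_self _).trans (abs_le_iSup_of_continuousOn isCompact_cdisc subset_rfl hfc hz)
  have hJ : ∀ z ∈ bdry, j z ≤ J := fun z hz =>
    (le_abs_self _).trans (abs_le_iSup_of_continuousOn (isCompact_sphere 0 1) subset_rfl hjc hz)
  have hK₀ : ∀ z ∈ odisc, |Kcur u 0 z| ≤ K₀ := fun z hz =>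
    abs_le_iSup_of_continuousOn isCompact_cdisc odisc_subset_cdisc (continuousOn_Kcur hflow h0T) hz
  have hF0 : 0 ≤ F := Real.iSup_nonneg fun _ => abs_nonneg _
  have hJ0 : 0 ≤ J := Real.iSup_nonneg fun _ => abs_nonneg _
  have hK0 : 0 ≤ K₀ := Real.iSup_nonneg fun _ => abs_nonneg _
  have hα₁ : 0 ≤ α₁ := (alphaC_pos hfc hfpos hflow h0T).le.trans (hα 0 h0T)
  have hβ₁ : 0 ≤ β₁ := (betaC_pos hjc hjpos hflow h0T).le.trans (hβ 0 h0T)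
  have hαF := mul_nonneg hα₁ hF0
  have hβJ := mul_nonneg hβ₁ hJ0
  have hV : ∀ t ∈ flowDom T, ∀ z ∈ cdisc, velocity T u (z, t) ≤ -κ := by
    intro t ht z hz
    refine le_of_not_touching isCompact_cdisc
      ((contDiffOn_velocity hT hflow.contDiffOn).continuousOn.mono
        (prod_mono subset_rfl (Icc_subset_flowDom ht))) (fun w hw => ?_)
      (fun s hs hle w hw => ?_) hz ht.1
    · have := velocity_zero_le hT hfpos hflow hα hα₁ hF hK₀ hw
      linarith
    · have hsT := mem_flowDom_of_le ht hs.1.le hs.2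
      obtain ⟨h1, h2⟩ := hC₁ s hsT hs.1
      obtain ⟨h3, h4⟩ := hC₂ s hsT hs.1
      have h5 := mul_le_mul_of_nonneg_right (hα s hsT) hF0
      have h6 := mul_le_mul_of_nonneg_right (hβ s hsT) hJ0
      exact velocity_not_touching hT hfc hfpos hjc hjpos hflow hsT hs.1 (neg_pos.2 hκneg) hF hJ hm₀
        h1 h2 h3 h4 (by linarith) (by linarith) (by linarith) (by linarith) hle hw
  have hk : ∀ t ∈ flowDom T, 0 < t → ∀ z ∈ bdry, κ ≤ kcur u t z := by
    intro t ht h0 z hz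
    have h1 := hV t ht z (bdry_subset_cdisc hz)
    have h2 := mul_pos (betaC_pos hjc hjpos hflow ht) (hjpos z hz)
    rw [kcur_eq_sub_velocity hflow ht h0 hz]
    linarith
  intro t ht
  rcases ht.1.eq_or_lt with rfl | h0
  · refine ⟨fun z hz => ?_, fun z hz => ?_⟩
    · have := neg_le_of_abs_le (hK₀ z hz)
      linarith
    · exact le_zero_time_of_le_pos_time hT continuousOn_const
        (continuousOn_kcur_time hT hflow (bdry_subset_cdisc hz)) (g₁ := fun _ => κ)
        fun t ht h0 => hk t ht h0 z hz
  · refine ⟨fun z hz => ?_, hk t ht h0⟩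
    have h1 := hV t ht z (odisc_subset_cdisc hz)
    have h2 := mul_pos (alphaC_pos hfc hfpos hflow ht) (hfpos z (odisc_subset_cdisc hz))
    rw [Kcur_eq_sub_velocity hT hflow ht h0 hz]
    linarith
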